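/- arXiv:1705.07081 — 4 statements merged into one kernel-verified Lean document; each statement's English description precedes it below -/
import Mathlib

section
/- Let U be a finite set and p_{U|XYZ} a conditional pmf such that the joint pmf p_XYZ·p_{U|XYZ} satisfies the two Markov chains U−X−Y and Z−(U,Y)−X. Then every rate R > I(X,Z;U|Y) (where I(X,Z;U|Y) denotes I((X,Z);U|Y)) is achievable without privacy for (p_XY, p_{Z|XY}). -/
open scoped BigOperators
open scoped Classical

namespace SC

/-- `p` is a probability mass function on a finite type. -/
def IsPMF {α : Type*} [Fintype α] (p : α → ℝ) : Prop :=
  (∀ a, 0 ≤ p a) ∧ ∑ a, p a = 1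

/-- Total variation distance between pmfs on a finite type. -/
noncomputable def tv {α : Type*} [Fintype α] (p q : α → ℝ) : ℝ :=
  (1 / 2) * ∑ a, |p a - q a|

/-- Shannon entropy (in bits) of the pushforward of the pmf `p` along `f`. -/
noncomputable def Hof {Ω β : Type*} [Fintype Ω] (p : Ω → ℝ) (f : Ω → β) : ℝ :=
  (∑ b ∈ Finset.univ.image f,
      Real.negMulLog (∑ a ∈ Finset.univ.filter (fun a => f a = b), p a)) / Real.log 2

/-- Conditional Shannon entropy `H(A | B)` (bits) computed from the joint pmf `p`. -/
noncomputable def condEnt {Ω α β : Type*} [Fintype Ω] (p : Ω → ℝ)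
    (A : Ω → α) (B : Ω → β) : ℝ :=
  Hof p (fun ω => (A ω, B ω)) - Hof p B

/-- Conditional mutual information `I(A ; C ∣ B)` (bits) from the joint pmf `p`. -/
noncomputable def cmi {Ω α β γ : Type*} [Fintype Ω] (p : Ω → ℝ)
    (A : Ω → α) (B : Ω → β) (C : Ω → γ) : ℝ :=
  Hof p (fun ω => (A ω, B ω)) + Hof p (fun ω => (B ω, C ω)) - Hof p B
    - Hof p (fun ω => (A ω, B ω, C ω))

/-- The joint pmf `p_XYZ(x,y,z) = p_XY(x,y) · p_{Z|XY}(z|x,y)`. -/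
noncomputable def jointXYZ {𝒳 𝒴 𝒵 : Type*} [Fintype 𝒳] [Fintype 𝒴] [Fintype 𝒵]
    (pXY : 𝒳 × 𝒴 → ℝ) (Q : 𝒳 → 𝒴 → 𝒵 → ℝ) : 𝒳 × 𝒴 × 𝒵 → ℝ :=
  fun w => pXY (w.1, w.2.1) * Q w.1 w.2.1 w.2.2

/-- The `n`-fold product of `p_XYZ`. -/
noncomputable def prodXYZ {𝒳 𝒴 𝒵 : Type*} [Fintype 𝒳] [Fintype 𝒴] [Fintype 𝒵]
    (pXY : 𝒳 × 𝒴 → ℝ) (Q : 𝒳 → 𝒴 → 𝒵 → ℝ) (n : ℕ) :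
    (Fin n → 𝒳) × (Fin n → 𝒴) × (Fin n → 𝒵) → ℝ :=
  fun w => ∏ i, jointXYZ pXY Q (w.1 i, w.2.1 i, w.2.2 i)

/-- The joint pmf of `(U, X, Y, Z)` obtained from `p_XYZ` and a conditional pmf
`p_{U|XYZ}` (with `U` ranging over `Fin k`). -/
noncomputable def jointU {𝒳 𝒴 𝒵 : Type*} [Fintype 𝒳] [Fintype 𝒴] [Fintype 𝒵]
    (pXY : 𝒳 × 𝒴 → ℝ) (Q : 𝒳 → 𝒴 → 𝒵 → ℝ) {k : ℕ}
    (pU : 𝒳 × 𝒴 × 𝒵 → Fin k → ℝ) : Fin k × 𝒳 × 𝒴 × 𝒵 → ℝ :=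
  fun w => jointXYZ pXY Q w.2 * pU w.2 w.1

/-- Message set cardinality `⌈2^{nR}⌉`. -/
noncomputable def msgCard (n : ℕ) (R : ℝ) : ℕ := ⌈(2 : ℝ) ^ ((n : ℝ) * R)⌉₊

/-- Joint pmf on `(Xⁿ, Yⁿ, M, Ẑⁿ)` induced by an `(n, 2^{nR})`-code `(enc, dec)`. -/
noncomputable def inducedPMF {𝒳 𝒴 𝒵 : Type*} [Fintype 𝒳] [Fintype 𝒴] [Fintype 𝒵]
    (pXY : 𝒳 × 𝒴 → ℝ) (n : ℕ) (R : ℝ)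
    (enc : (Fin n → 𝒳) → Fin (msgCard n R) → ℝ)
    (dec : Fin (msgCard n R) → (Fin n → 𝒴) → (Fin n → 𝒵) → ℝ) :
    (Fin n → 𝒳) × (Fin n → 𝒴) × Fin (msgCard n R) × (Fin n → 𝒵) → ℝ :=
  fun w => (∏ i, pXY (w.1 i, w.2.1 i)) * enc w.1 w.2.2.1 * dec w.2.2.1 w.2.1 w.2.2.2

/-- A rate `R ≥ 0` is achievable without privacy for `(p_XY, p_{Z|XY})`. -/
def AchievableNP {𝒳 𝒴 𝒵 : Type*} [Fintype 𝒳] [Fintype 𝒴] [Fintype 𝒵]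
    (pXY : 𝒳 × 𝒴 → ℝ) (Q : 𝒳 → 𝒴 → 𝒵 → ℝ) (R : ℝ) : Prop :=
  0 ≤ R ∧
  ∃ enc : (n : ℕ) → (Fin n → 𝒳) → Fin (msgCard n R) → ℝ,
  ∃ dec : (n : ℕ) → Fin (msgCard n R) → (Fin n → 𝒴) → (Fin n → 𝒵) → ℝ,
    (∀ n xs, IsPMF (enc n xs)) ∧ (∀ n m ys, IsPMF (dec n m ys)) ∧
    ∀ ε : ℝ, 0 < ε → ∃ n : ℕ, 0 < n ∧
      tv (fun w : (Fin n → 𝒳) × (Fin n → 𝒴) × (Fin n → 𝒵) =>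
            ∑ m, inducedPMF pXY n R (enc n) (dec n) (w.1, w.2.1, m, w.2.2))
         (prodXYZ pXY Q n) ≤ ε

/-- `p_{U|XYZ}` is a conditional pmf whose joint pmf `p_XYZ · p_{U|XYZ}` satisfies the
two Markov chains `U−X−Y` and `Z−(U,Y)−X`. -/
def NPAux {𝒳 𝒴 𝒵 : Type*} [Fintype 𝒳] [Fintype 𝒴] [Fintype 𝒵]
    (pXY : 𝒳 × 𝒴 → ℝ) (Q : 𝒳 → 𝒴 → 𝒵 → ℝ) {k : ℕ}
    (pU : 𝒳 × 𝒴 × 𝒵 → Fin k → ℝ) : Prop :=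
  (∀ w, IsPMF (pU w)) ∧
  cmi (jointU pXY Q pU) (fun w => w.1) (fun w => w.2.1) (fun w => w.2.2.1) = 0 ∧
  cmi (jointU pXY Q pU) (fun w => w.2.2.2) (fun w => (w.1, w.2.2.1)) (fun w => w.2.1) = 0

/-- The sum over all functions of a product of pointwise factors is the product of the sums. -/
theorem sum_prod_pi {ι O : Type*} [Fintype ι] [DecidableEq ι] [Fintype O] (h : ι → O → ℝ) :
    ∑ G : ι → O, ∏ i, h i (G i) = ∏ i, ∑ o, h i o := by
  rw [Finset.prod_univ_sum, Fintype.piFinset_univ]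

/-- Independent coordinates form a pmf on the function space. -/
theorem IsPMF.pi {ι O : Type*} [Fintype ι] [DecidableEq ι] [Fintype O] {p : ι → O → ℝ}
    (hp : ∀ i, IsPMF (p i)) : IsPMF (fun f : ι → O => ∏ i, p i (f i)) :=
  ⟨fun _ => Finset.prod_nonneg fun i _ => (hp i).1 _, by
    rw [sum_prod_pi]
    exact Finset.prod_eq_one fun i _ => (hp i).2⟩

/-- Sums over pairs of functions are sums over functions into the product. -/
theorem sum_pi_prod {ι A B : Type*} [Fintype ι] [DecidableEq ι] [Fintype A] [Fintype B]
    (F : (ι → A) → (ι → B) → ℝ) :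
    ∑ x, ∑ y, F x y = ∑ w : ι → A × B, F (fun i => (w i).1) (fun i => (w i).2) := by
  rw [← Fintype.sum_prod_type']
  exact (Fintype.sum_equiv (Equiv.arrowProdEquivProdArrow ι (fun _ => A) (fun _ => B)) _ _
    (fun _ => rfl)).symm

theorem sum_pi_mul_apply {ι O : Type*} [Fintype ι] [DecidableEq ι] [Fintype O]
    {w : O → ℝ} (hw : IsPMF w)
    (u : ι) (f : O → ℝ) :
    ∑ G : ι → O, (∏ i, w (G i)) * f (G u) = ∑ o, w o * f o := by
  have h1 : ∀ G : ι → O, (∏ i, w (G i)) * f (G u)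
      = ∏ i, (w (G i) * if i = u then f (G i) else 1) := by
    intro G
    rw [Finset.prod_mul_distrib]
    simp
  simp_rw [h1]
  rw [sum_prod_pi (fun i o => w o * if i = u then f o else 1),
    Finset.prod_eq_single u]
  · simp
  · intro i _ hi
    simp [hi, hw.2]
  · simp

theorem sum_pi_mul_apply_mul_apply {ι O : Type*} [Fintype ι] [DecidableEq ι] [Fintype O] {w : O → ℝ}
    (hw : IsPMF w) {u v : ι} (huv : u ≠ v) (f g : O → ℝ) :
    ∑ G : ι → O, (∏ i, w (G i)) * (f (G u) * g (G v))
      = (∑ o, w o * f o) * ∑ o, w o * g o := by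
  have h1 : ∀ G : ι → O, (∏ i, w (G i)) * (f (G u) * g (G v))
      = ∏ i, (w (G i) * ((if i = u then f (G i) else 1) * if i = v then g (G i) else 1)) := by
    intro G
    rw [Finset.prod_mul_distrib, Finset.prod_mul_distrib]
    simp
  simp_rw [h1]
  rw [sum_prod_pi (fun i o => w o * ((if i = u then f o else 1) * if i = v then g o else 1))]
  have h2 : ∀ i, (∑ o, w o * ((if i = u then f o else 1) * if i = v then g o else 1))
      = (if i = u then ∑ o, w o * f o else 1) * if i = v then ∑ o, w o * g o else 1 := by
    intro i
    by_cases hu : i = u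
    · have hv : i ≠ v := fun h => huv (hu.symm.trans h)
      simp [hu, huv]
    · by_cases hv : i = v
      · simp [hv, Ne.symm huv]
      · simp [hu, hv, hw.2]
  simp_rw [h2]
  rw [Finset.prod_mul_distrib]
  simp

/-- Second moment of a linear statistic of centred independent coordinates. -/
theorem sum_pi_mul_sq {ι O : Type*} [Fintype ι] [DecidableEq ι] [Fintype O]
    {w : O → ℝ} (hw : IsPMF w)
    (c : O → ℝ) (hc : ∑ o, w o * c o = 0) (d : ι → ℝ) :
    ∑ G : ι → O, (∏ i, w (G i)) * (∑ u, c (G u) * d u) ^ 2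
      = (∑ o, w o * c o ^ 2) * ∑ u, d u ^ 2 := by
  have h1 : ∀ G : ι → O, (∏ i, w (G i)) * (∑ u, c (G u) * d u) ^ 2
      = ∑ u, ∑ v, d u * d v * ((∏ i, w (G i)) * (c (G u) * c (G v))) := by
    intro G
    rw [sq, Finset.sum_mul_sum, Finset.mul_sum]
    refine Finset.sum_congr rfl fun u _ => ?_
    rw [Finset.mul_sum]
    exact Finset.sum_congr rfl fun v _ => by ring
  simp_rw [h1]
  rw [Finset.sum_comm, Finset.mul_sum]
  refine Finset.sum_congr rfl fun u _ => ?_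
  rw [Finset.sum_comm]
  simp_rw [← Finset.mul_sum]
  rw [Finset.sum_eq_single u]
  · have := sum_pi_mul_apply hw u (fun o => c o * c o)
    rw [this]
    simp only [← sq]
    ring
  · intro v _ hv
    rw [sum_pi_mul_apply_mul_apply hw (Ne.symm hv), hc]
    simp
  · simp

/-- If the mean of `f` under a pmf is at most `B`, some point has value at most `B`. -/
theorem IsPMF.exists_le {O : Type*} [Fintype O] {w : O → ℝ} (hw : IsPMF w) (f : O → ℝ) {B : ℝ}
    (h : ∑ o, w o * f o ≤ B) : ∃ o, f o ≤ B := by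
  by_contra! hcon
  have h1 : ∀ o, w o * B ≤ w o * f o := fun o =>
    mul_le_mul_of_nonneg_left (hcon o).le (hw.1 o)
  have h3 : ∑ o, w o * B = B := by rw [← Finset.sum_mul, hw.2, one_mul]
  have h4 : ∀ o, w o * B = w o * f o := by
    have := (Finset.sum_eq_sum_iff_of_le (fun o _ => h1 o)).1
      (le_antisymm (Finset.sum_le_sum fun o _ => h1 o) (h.trans h3.ge))
    exact fun o => this o (Finset.mem_univ o)
  have h5 : ∀ o, w o = 0 := by
    intro o
    by_contra hne
    exact absurd (mul_left_cancel₀ hne (h4 o)) (hcon o).ne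
  have := hw.2
  simp [h5] at this

/-- Membership indicator of a codeword: `o = some m` means that the codeword is selected and
placed in bin `m`, `o = none` that it is not selected. -/
noncomputable def sel {M : ℕ} (o : Option (Fin M)) : ℝ := ∑ m, if o = some m then 1 else 0

theorem sel_none {M : ℕ} : sel (none : Option (Fin M)) = 0 := by simp [sel]

theorem sel_some {M : ℕ} (m : Fin M) : sel (some m) = 1 := by simp [sel]

theorem sel_nonneg {M : ℕ} (o : Option (Fin M)) : 0 ≤ sel o := by
  cases o <;> simp [sel_none, sel_some]

/-- Law selecting a codeword with probability `θ` and placing it in a uniform bin. -/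
noncomputable def selLaw (M : ℕ) (θ : ℝ) : Option (Fin M) → ℝ :=
  fun o => o.elim (1 - θ) (fun _ => θ / M)

theorem selLaw_isPMF {M : ℕ} (hM : 0 < M) {θ : ℝ} (h0 : 0 < θ) (h1 : θ ≤ 1) :
    IsPMF (selLaw M θ) := by
  have hM' : (M : ℝ) ≠ 0 := by positivity
  refine ⟨?_, ?_⟩
  · rintro (_ | m)
    · simpa [selLaw] using h1
    · simp only [selLaw, Option.elim]; positivity
  · rw [Fintype.sum_option]
    simp only [selLaw, Option.elim, Finset.sum_const, Finset.card_univ, Fintype.card_fin,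
      nsmul_eq_mul]
    field_simp
    ring

theorem sum_selLaw_mul_sel {M : ℕ} (hM : 0 < M) (θ : ℝ) :
    ∑ o, selLaw M θ o * sel o = θ := by
  have hM' : (M : ℝ) ≠ 0 := by positivity
  rw [Fintype.sum_option]
  simp only [selLaw, Option.elim, Finset.sum_const, Finset.card_univ, Fintype.card_fin,
      nsmul_eq_mul, sel_none, sel_some]
  field_simp
  ring

theorem sum_selLaw_mul_ite {M : ℕ} (θ : ℝ) (m : Fin M) :
    ∑ o, selLaw M θ o * (if o = some m then 1 else 0) = θ / M := by
  rw [Fintype.sum_option]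
  simp [selLaw]

theorem sum_selLaw_mul_center {M : ℕ} (hM : 0 < M) {θ : ℝ} (h0 : 0 < θ) (h1 : θ ≤ 1) :
    ∑ o, selLaw M θ o * (sel o / θ - 1) = 0 := by
  have h2 : ∀ o, selLaw M θ o * (sel o / θ - 1) = selLaw M θ o * sel o / θ - selLaw M θ o :=
    fun o => by ring
  simp_rw [h2]
  rw [Finset.sum_sub_distrib, ← Finset.sum_div, sum_selLaw_mul_sel hM,
    (selLaw_isPMF hM h0 h1).2, div_self h0.ne', sub_self]

theorem sum_selLaw_mul_center_sq {M : ℕ} (hM : 0 < M) {θ : ℝ} (h0 : 0 < θ) :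
    ∑ o, selLaw M θ o * (sel o / θ - 1) ^ 2 = (1 - θ) / θ := by
  have hM' : (M : ℝ) ≠ 0 := by positivity
  rw [Fintype.sum_option]
  simp only [selLaw, Option.elim, Finset.sum_const, Finset.card_univ, Fintype.card_fin,
      nsmul_eq_mul, sel_none, sel_some]
  field_simp
  ring

theorem sum_selLaw_mul_abs_center_le {M : ℕ} (hM : 0 < M) {θ : ℝ} (h0 : 0 < θ) (h1 : θ ≤ 1) :
    ∑ o, selLaw M θ o * |sel o / θ - 1| ≤ 2 := by
  have hw := selLaw_isPMF hM h0 h1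
  calc ∑ o, selLaw M θ o * |sel o / θ - 1|
      ≤ ∑ o, (selLaw M θ o * sel o / θ + selLaw M θ o) := by
        refine Finset.sum_le_sum fun o _ => ?_
        have : |sel o / θ - 1| ≤ sel o / θ + 1 := by
          have := div_nonneg (sel_nonneg o) h0.le
          rw [abs_le]; constructor <;> linarith
        calc _ ≤ selLaw M θ o * (sel o / θ + 1) := mul_le_mul_of_nonneg_left this (hw.1 o)
          _ = _ := by ring
    _ = 2 := by
        rw [Finset.sum_add_distrib, ← Finset.sum_div, sum_selLaw_mul_sel hM, hw.2,
          div_self h0.ne']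
        norm_num

/-- Soft covering: the randomly selected codewords carry, after rescaling, almost the total
mass of `d`. -/
theorem soft_covering {U : Type*} [Fintype U] {M : ℕ} (hM : 0 < M) {θ : ℝ} (h0 : 0 < θ)
    (h1 : θ ≤ 1) {α η : ℝ} (hα : 0 ≤ α) (hη : 0 < η) (d : U → ℝ) (hd : ∀ u, 0 ≤ d u) :
    ∑ G : U → Option (Fin M), (∏ i, selLaw M θ (G i)) * |∑ u, (sel (G u) / θ - 1) * d u|
      ≤ (η + α * ((1 - θ) / θ) / η) * ∑ u, d u
        + 2 * ∑ u, if α * ∑ v, d v < d u then d u else 0 := by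
  have hw := selLaw_isPMF hM h0 h1
  have hW : IsPMF (fun G : U → Option (Fin M) => ∏ i, selLaw M θ (G i)) := IsPMF.pi fun _ => hw
  set D := ∑ u, d u with hD
  have hD0 : 0 ≤ D := Finset.sum_nonneg fun u _ => hd u
  rcases hD0.eq_or_lt with hz | hpos
  · have hdz : ∀ u, d u = 0 := fun u =>
      (Finset.sum_eq_zero_iff_of_nonneg (fun u _ => hd u)).1 hz.symm u (Finset.mem_univ u)
    simp [hdz, ← hz]
  set d1 : U → ℝ := fun u => if α * D < d u then 0 else d u with hd1
  set d2 : U → ℝ := fun u => if α * D < d u then d u else 0 with hd2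
  have hsplit : ∀ u, d u = d1 u + d2 u := by
    intro u; simp only [hd1, hd2]; split_ifs <;> simp
  have hd2n : ∀ u, 0 ≤ d2 u := by
    intro u; simp only [hd2]; split_ifs; exacts [hd u, le_rfl]
  have hpt : ∀ G : U → Option (Fin M), |∑ u, (sel (G u) / θ - 1) * d u| ≤
      η * D + (∑ u, (sel (G u) / θ - 1) * d1 u) ^ 2 / (η * D)
        + ∑ u, |sel (G u) / θ - 1| * d2 u := by
    intro G
    have e1 : ∑ u, (sel (G u) / θ - 1) * d u = ∑ u, (sel (G u) / θ - 1) * d1 u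
        + ∑ u, (sel (G u) / θ - 1) * d2 u := by
      rw [← Finset.sum_add_distrib]
      exact Finset.sum_congr rfl fun u _ => by rw [hsplit u]; ring
    rw [e1]
    refine (abs_add_le _ _).trans (add_le_add ?_ ?_)
    · have ht : 0 < η * D := mul_pos hη hpos
      generalize (∑ u, (sel (G u) / θ - 1) * d1 u) = s
      generalize η * D = t at ht
      rcases le_total |s| t with h | h
      · have : 0 ≤ s ^ 2 / t := by positivity
        linarith
      · have : |s| ≤ s ^ 2 / t := by
          rw [le_div_iff₀ ht, ← sq_abs, sq]
          exact mul_le_mul_of_nonneg_left h (abs_nonneg s)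
        linarith
    · refine (Finset.abs_sum_le_sum_abs _ _).trans (Finset.sum_le_sum fun u _ => ?_)
      rw [abs_mul, abs_of_nonneg (hd2n u)]
  have hsq : ∑ u, d1 u ^ 2 ≤ α * D * D := by
    rw [hD, Finset.mul_sum, ← hD]
    refine Finset.sum_le_sum fun u _ => ?_
    simp only [hd1]
    split_ifs with h
    · have : 0 ≤ α * D := mul_nonneg hα hD0
      simp [mul_nonneg this (hd u)]
    · rw [sq]; exact mul_le_mul_of_nonneg_right (not_lt.1 h) (hd u)
  calc _ ≤ ∑ G : U → Option (Fin M), (∏ i, selLaw M θ (G i)) *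
        (η * D + (∑ u, (sel (G u) / θ - 1) * d1 u) ^ 2 / (η * D)
        + ∑ u, |sel (G u) / θ - 1| * d2 u) :=
        Finset.sum_le_sum fun G _ => mul_le_mul_of_nonneg_left (hpt G) (hW.1 G)
    _ = η * D + ((1 - θ) / θ * ∑ u, d1 u ^ 2) / (η * D)
        + ∑ u, (∑ o, selLaw M θ o * |sel o / θ - 1|) * d2 u := by
        simp_rw [mul_add]
        rw [Finset.sum_add_distrib, Finset.sum_add_distrib, ← Finset.sum_mul, hW.2, one_mul]
        congr 1
        · congr 1
          rw [← sum_selLaw_mul_center_sq hM h0,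
            ← sum_pi_mul_sq hw _ (sum_selLaw_mul_center hM h0 h1), Finset.sum_div]
          exact Finset.sum_congr rfl fun G _ => by ring
        · simp_rw [Finset.mul_sum]
          rw [Finset.sum_comm]
          refine Finset.sum_congr rfl fun u _ => ?_
          rw [← sum_pi_mul_apply hw u (fun o => |sel o / θ - 1|), Finset.sum_mul]
          exact Finset.sum_congr rfl fun G _ => by ring
    _ ≤ η * D + ((1 - θ) / θ * (α * D * D)) / (η * D) + ∑ u, 2 * d2 u := by
        refine add_le_add (add_le_add le_rfl ?_) (Finset.sum_le_sum fun u _ => ?_)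
        · have hq : 0 ≤ (1 - θ) / θ := div_nonneg (by linarith) h0.le
          exact div_le_div_of_nonneg_right (mul_le_mul_of_nonneg_left hsq hq) (by positivity)
        · exact mul_le_mul_of_nonneg_right (sum_selLaw_mul_abs_center_le hM h0 h1) (hd2n u)
    _ = _ := by
        rw [← Finset.mul_sum]
        have := hpos.ne'
        field_simp

/-- Bound on the indicator that the selected codeword `u` is not recovered from its bin by a
decoder looking for a selected codeword satisfying `S`: either `u` fails `S`, or another selected
codeword of the same bin satisfies `S`. -/
noncomputable def confusion {U : Type*} [Fintype U] {M : ℕ} (S : U → Prop)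
    (G : U → Option (Fin M)) (u : U) : ℝ :=
  ∑ m, ((if G u = some m then 1 else 0) * (if S u then 0 else 1)
    + ∑ v, if v ≠ u ∧ S v then
        (if G u = some m then 1 else 0) * (if G v = some m then 1 else 0) else 0)

theorem sum_selLaw_mul_confusion_le {U : Type*} [Fintype U] {M : ℕ} (hM : 0 < M) {θ : ℝ}
    (h0 : 0 < θ) (h1 : θ ≤ 1) (S : U → Prop) (u : U) :
    ∑ G : U → Option (Fin M), (∏ i, selLaw M θ (G i)) * confusion S G u
      ≤ θ * ((if S u then 0 else 1) + θ / M * ∑ v, if S v then 1 else 0) := by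
  have hw := selLaw_isPMF hM h0 h1
  have hM' : (M : ℝ) ≠ 0 := by positivity
  have e1 : ∀ m : Fin M, ∑ G : U → Option (Fin M), (∏ i, selLaw M θ (G i)) *
      ((if G u = some m then 1 else 0) * (if S u then 0 else 1))
      = θ / M * (if S u then 0 else 1) := by
    intro m
    rw [← sum_selLaw_mul_ite θ m,
      ← sum_pi_mul_apply hw u (fun o => if o = some m then (1 : ℝ) else 0), Finset.sum_mul]
    exact Finset.sum_congr rfl fun G _ => by ring
  have e2 : ∀ (m : Fin M) (v : U), ∑ G : U → Option (Fin M), (∏ i, selLaw M θ (G i)) *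
      (if v ≠ u ∧ S v then (if G u = some m then 1 else 0) * (if G v = some m then 1 else 0)
        else 0)
      ≤ θ / M * (θ / M) * if S v then 1 else 0 := by
    intro m v
    by_cases hv : v ≠ u ∧ S v
    · have := sum_pi_mul_apply_mul_apply hw (Ne.symm hv.1)
        (fun o => if o = some m then (1 : ℝ) else 0) (fun o => if o = some m then (1 : ℝ) else 0)
      rw [sum_selLaw_mul_ite] at this
      simp only [hv, and_self, if_true, mul_one, ne_eq, not_false_eq_true]
      exact this.le
    · simp only [hv, if_false, mul_zero, Finset.sum_const_zero]
      split_ifs <;> positivity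
  calc _ = ∑ m : Fin M, (θ / M * (if S u then 0 else 1)
        + ∑ v, ∑ G : U → Option (Fin M), (∏ i, selLaw M θ (G i)) *
          (if v ≠ u ∧ S v then (if G u = some m then 1 else 0) * (if G v = some m then 1 else 0)
            else 0)) := by
        simp only [confusion]
        simp_rw [Finset.mul_sum (s := (Finset.univ : Finset (Fin M)))]
        rw [Finset.sum_comm]
        refine Finset.sum_congr rfl fun m _ => ?_
        simp_rw [mul_add]
        rw [Finset.sum_add_distrib, e1]
        congr 1
        rw [Finset.sum_comm]
        exact Finset.sum_congr rfl fun G _ => by rw [Finset.mul_sum]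
    _ ≤ ∑ m : Fin M, (θ / M * (if S u then 0 else 1)
        + ∑ v, θ / M * (θ / M) * if S v then 1 else 0) := by
        gcongr with m _ v _
        exact e2 m v
    _ = _ := by
        rw [Finset.sum_const, Finset.card_univ, Fintype.card_fin, nsmul_eq_mul,
          ← Finset.mul_sum]
        field_simp

/-- The code built from a selection `G`: the encoder picks a selected codeword with its
conditional probability and sends its bin, the decoder recovers it using `S` and feeds it to the
output channel. -/
theorem exists_code_of_selection {U X Y Z : Type*} [Fintype U] [Fintype X] [Fintype Y]
    [Fintype Z] [Nonempty U] {M : ℕ} (hM : 0 < M) {θ : ℝ} (h0 : 0 < θ)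
    {p : X → Y → ℝ} (hp : ∀ x y, 0 ≤ p x y) {a : X → U → ℝ} (ha : ∀ x, IsPMF (a x))
    {b : U → Y → Z → ℝ} (hb : ∀ u y, IsPMF (b u y)) (S : U → Y → Prop)
    (G : U → Option (Fin M)) :
    ∃ enc : X → Fin M → ℝ, ∃ dec : Fin M → Y → Z → ℝ,
      (∀ x, IsPMF (enc x)) ∧ (∀ m y, IsPMF (dec m y)) ∧
      ∑ x, ∑ y, ∑ z, |p x y * (∑ m, enc x m * dec m y z) - ∑ u, p x y * a x u * b u y z|
        ≤ 2 * ∑ x, ∑ y, ∑ z, |∑ u, (sel (G u) / θ - 1) * (p x y * a x u * b u y z)|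
          + 2 / θ * ∑ x, ∑ y, ∑ u, p x y * a x u * confusion (fun v => S v y) G u := by
  set g : U → Fin M → ℝ := fun u m => if G u = some m then 1 else 0 with hg
  have hg0 : ∀ u m, 0 ≤ g u m := fun u m => by simp only [hg]; split_ifs <;> norm_num
  have hsel : ∀ u, sel (G u) = ∑ m, g u m := fun u => rfl
  set N : X → Fin M → ℝ := fun x m => ∑ u, a x u * g u m with hN
  have hN0 : ∀ x m, 0 ≤ N x m := fun x m =>
    Finset.sum_nonneg fun u _ => mul_nonneg ((ha x).1 u) (hg0 u m)
  set A : X → ℝ := fun x => ∑ m, N x m with hA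
  have hAs : ∀ x, A x = ∑ u, a x u * sel (G u) := by
    intro x
    simp only [hA, hN, hsel, Finset.mul_sum]
    exact Finset.sum_comm
  let m0 : Fin M := ⟨0, hM⟩
  set enc : X → Fin M → ℝ := fun x m =>
    if A x = 0 then (if m = m0 then 1 else 0) else N x m / A x with henc
  set uh : Fin M → Y → U := fun m y =>
    if h : ∃ u, G u = some m ∧ S u y then h.choose else Classical.arbitrary U with huh
  have hencP : ∀ x, IsPMF (enc x) := by
    intro x
    by_cases h : A x = 0
    · refine ⟨fun m => ?_, ?_⟩
      · simp only [henc, h, if_true]; split_ifs <;> norm_num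
      · simp [henc, h]
    · refine ⟨fun m => ?_, ?_⟩
      · simp only [henc, h, if_false]
        exact div_nonneg (hN0 x m) (Finset.sum_nonneg fun m _ => hN0 x m)
      · simp only [henc, h, if_false]
        rw [← Finset.sum_div]
        exact div_self h
  have henc_dist : ∀ x, ∑ m, |enc x m - N x m / θ| = |A x / θ - 1| := by
    intro x
    by_cases h : A x = 0
    · have hNz : ∀ m, N x m = 0 := fun m =>
        (Finset.sum_eq_zero_iff_of_nonneg (fun m _ => hN0 x m)).1 h m (Finset.mem_univ m)
      simp only [hNz, zero_div, sub_zero, h, zero_sub, abs_neg, abs_one]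
      rw [← (hencP x).2]
      exact Finset.sum_congr rfl fun m _ => abs_of_nonneg ((hencP x).1 m)
    · have hApos : 0 < A x := lt_of_le_of_ne (Finset.sum_nonneg fun m _ => hN0 x m) (Ne.symm h)
      have : ∀ m, |enc x m - N x m / θ| = N x m * |1 / A x - 1 / θ| := by
        intro m
        rw [← abs_of_nonneg (hN0 x m), ← abs_mul, abs_of_nonneg (hN0 x m)]
        simp only [henc, h, if_false]
        congr 1
        ring
      simp_rw [this]
      rw [← Finset.sum_mul]
      change A x * _ = _
      nth_rewrite 1 [← abs_of_pos hApos]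
      rw [← abs_mul, abs_sub_comm]
      congr 1
      field_simp
  have hrec : ∀ u m y, g u m * (∑ z, |b (uh m y) y z - b u y z|)
      ≤ 2 * (g u m * (if S u y then 0 else 1)
        + ∑ v, if v ≠ u ∧ S v y then g u m * g v m else 0) := by
    intro u m y
    have htv : ∑ z, |b (uh m y) y z - b u y z| ≤ 2 := by
      calc _ ≤ ∑ z, (b (uh m y) y z + b u y z) := by
            refine Finset.sum_le_sum fun z _ => ?_
            have h1 := (hb (uh m y) y).1 z
            have h2 := (hb u y).1 z
            rw [abs_le]; constructor <;> linarith
        _ = 2 := by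
            rw [Finset.sum_add_distrib, (hb _ _).2, (hb _ _).2]; norm_num
    have hs0 : 0 ≤ ∑ v, if v ≠ u ∧ S v y then g u m * g v m else 0 :=
      Finset.sum_nonneg fun v _ => by
        split_ifs
        exacts [mul_nonneg (hg0 u m) (hg0 v m), le_rfl]
    by_cases hG : G u = some m
    swap
    · have : g u m = 0 := by simp [hg, hG]
      simp [this]
    have hg1 : g u m = 1 := by simp [hg, hG]
    by_cases hS : S u y
    swap
    · simp only [hS, if_false, hg1, one_mul] at hs0 ⊢
      linarith
    by_cases heq : uh m y = u
    · rw [heq]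
      simp only [sub_self, abs_zero, Finset.sum_const_zero, mul_zero, hS, if_true, zero_add]
      linarith
    · have hex : ∃ u, G u = some m ∧ S u y := ⟨u, hG, hS⟩
      have hspec : G (uh m y) = some m ∧ S (uh m y) y := by
        simp only [huh, hex, dif_pos]
        exact hex.choose_spec
      have hle : (1 : ℝ) ≤ ∑ v, if v ≠ u ∧ S v y then g u m * g v m else 0 := by
        refine le_trans ?_ (Finset.single_le_sum (f := fun v =>
          if v ≠ u ∧ S v y then g u m * g v m else 0) (fun v _ => ?_)
          (Finset.mem_univ (uh m y)))
        · simp [heq, hspec.2, hg, hG, hspec.1]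
        · split_ifs
          exacts [mul_nonneg (hg0 u m) (hg0 v m), le_rfl]
      simp only [hS, if_true, hg1, mul_zero, one_mul, zero_add] at hle ⊢
      linarith
  refine ⟨enc, fun m y => b (uh m y) y, hencP, fun m y => hb _ _, ?_⟩
  have key : ∀ x y, ∑ z, |p x y * (∑ m, enc x m * b (uh m y) y z) - ∑ u, p x y * a x u * b u y z|
      ≤ 2 * ∑ z, |∑ u, (sel (G u) / θ - 1) * (p x y * a x u * b u y z)|
        + 2 / θ * ∑ u, p x y * a x u * confusion (fun v => S v y) G u := by
    intro x y
    have hdec : ∀ z, p x y * (∑ m, enc x m * b (uh m y) y z) - ∑ u, p x y * a x u * b u y z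
        = p x y * (∑ m, (enc x m - N x m / θ) * b (uh m y) y z)
          + (p x y / θ * (∑ u, a x u * ∑ m, g u m * (b (uh m y) y z - b u y z))
          + ∑ u, (sel (G u) / θ - 1) * (p x y * a x u * b u y z)) := by
      intro z
      have e1 : ∑ m, (enc x m - N x m / θ) * b (uh m y) y z
          = ∑ m, enc x m * b (uh m y) y z - (∑ m, N x m * b (uh m y) y z) / θ := by
        rw [Finset.sum_div, ← Finset.sum_sub_distrib]
        exact Finset.sum_congr rfl fun m _ => by ring
      have e2 : ∑ u, a x u * ∑ m, g u m * (b (uh m y) y z - b u y z)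
          = ∑ m, N x m * b (uh m y) y z - ∑ u, a x u * sel (G u) * b u y z := by
        simp only [hN, hsel, Finset.sum_mul, Finset.mul_sum]
        rw [Finset.sum_comm (s := (Finset.univ : Finset (Fin M))), ← Finset.sum_sub_distrib]
        refine Finset.sum_congr rfl fun u _ => ?_
        rw [← Finset.sum_sub_distrib]
        exact Finset.sum_congr rfl fun m _ => by ring
      have e3 : ∑ u, (sel (G u) / θ - 1) * (p x y * a x u * b u y z)
          = p x y / θ * (∑ u, a x u * sel (G u) * b u y z) - ∑ u, p x y * a x u * b u y z := by
        rw [Finset.mul_sum, ← Finset.sum_sub_distrib]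
        exact Finset.sum_congr rfl fun u _ => by ring
      rw [e1, e2, e3]
      ring
    have t1 : ∑ z, |p x y * (∑ m, (enc x m - N x m / θ) * b (uh m y) y z)|
        ≤ ∑ z, |∑ u, (sel (G u) / θ - 1) * (p x y * a x u * b u y z)| := by
      calc _ ≤ ∑ z, p x y * ∑ m, |enc x m - N x m / θ| * b (uh m y) y z := by
            refine Finset.sum_le_sum fun z _ => ?_
            rw [abs_mul, abs_of_nonneg (hp x y)]
            refine mul_le_mul_of_nonneg_left ?_ (hp x y)
            refine (Finset.abs_sum_le_sum_abs _ _).trans (Finset.sum_le_sum fun m _ => ?_)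
            rw [abs_mul, abs_of_nonneg ((hb _ _).1 z)]
        _ = p x y * ∑ m, |enc x m - N x m / θ| := by
            rw [← Finset.mul_sum, Finset.sum_comm]
            congr 1
            refine Finset.sum_congr rfl fun m _ => ?_
            rw [← Finset.mul_sum, (hb _ _).2, mul_one]
        _ = |p x y * (A x / θ - 1)| := by
            rw [henc_dist, abs_mul, abs_of_nonneg (hp x y)]
        _ = |∑ z, ∑ u, (sel (G u) / θ - 1) * (p x y * a x u * b u y z)| := by
            rw [Finset.sum_comm, hAs]
            congr 1
            have : ∀ u, ∑ z, (sel (G u) / θ - 1) * (p x y * a x u * b u y z)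
                = p x y * (a x u * sel (G u)) / θ - p x y * a x u := by
              intro u
              rw [← Finset.mul_sum, ← Finset.mul_sum, (hb _ _).2]
              ring
            simp_rw [this]
            rw [Finset.sum_sub_distrib, ← Finset.mul_sum, (ha x).2, ← Finset.sum_div,
              ← Finset.mul_sum]
            ring
        _ ≤ _ := Finset.abs_sum_le_sum_abs _ _
    have t2 : ∑ z, |p x y / θ * (∑ u, a x u * ∑ m, g u m * (b (uh m y) y z - b u y z))|
        ≤ 2 / θ * ∑ u, p x y * a x u * confusion (fun v => S v y) G u := by
      have hpθ : 0 ≤ p x y / θ := div_nonneg (hp x y) h0.le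
      calc _ ≤ ∑ z, p x y / θ * ∑ u, a x u * ∑ m, g u m * |b (uh m y) y z - b u y z| := by
            refine Finset.sum_le_sum fun z _ => ?_
            rw [abs_mul, abs_of_nonneg hpθ]
            refine mul_le_mul_of_nonneg_left ?_ hpθ
            refine (Finset.abs_sum_le_sum_abs _ _).trans (Finset.sum_le_sum fun u _ => ?_)
            rw [abs_mul, abs_of_nonneg ((ha x).1 u)]
            refine mul_le_mul_of_nonneg_left ?_ ((ha x).1 u)
            refine (Finset.abs_sum_le_sum_abs _ _).trans (Finset.sum_le_sum fun m _ => ?_)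
            rw [abs_mul, abs_of_nonneg (hg0 u m)]
        _ = p x y / θ * ∑ u, a x u * ∑ m, g u m * ∑ z, |b (uh m y) y z - b u y z| := by
            rw [← Finset.mul_sum, Finset.sum_comm]
            congr 1
            refine Finset.sum_congr rfl fun u _ => ?_
            rw [← Finset.mul_sum, Finset.sum_comm]
            congr 1
            refine Finset.sum_congr rfl fun m _ => ?_
            rw [← Finset.mul_sum]
        _ ≤ p x y / θ * ∑ u, a x u * ∑ m, 2 * (g u m * (if S u y then 0 else 1)
              + ∑ v, if v ≠ u ∧ S v y then g u m * g v m else 0) := by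
            refine mul_le_mul_of_nonneg_left (Finset.sum_le_sum fun u _ => ?_) hpθ
            exact mul_le_mul_of_nonneg_left (Finset.sum_le_sum fun m _ => hrec u m y) ((ha x).1 u)
        _ = _ := by
            simp_rw [← Finset.mul_sum]
            rw [Finset.mul_sum, Finset.mul_sum]
            refine Finset.sum_congr rfl fun u _ => ?_
            simp only [confusion, hg]
            ring
    simp_rw [hdec]
    calc _ ≤ ∑ z, (|p x y * (∑ m, (enc x m - N x m / θ) * b (uh m y) y z)|
          + (|p x y / θ * (∑ u, a x u * ∑ m, g u m * (b (uh m y) y z - b u y z))|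
          + |∑ u, (sel (G u) / θ - 1) * (p x y * a x u * b u y z)|)) := by
          refine Finset.sum_le_sum fun z _ => (abs_add_le _ _).trans ?_
          exact add_le_add le_rfl (abs_add_le _ _)
      _ ≤ _ := by
          rw [Finset.sum_add_distrib, Finset.sum_add_distrib]
          linarith
  calc _ ≤ ∑ x, ∑ y, (2 * ∑ z, |∑ u, (sel (G u) / θ - 1) * (p x y * a x u * b u y z)|
        + 2 / θ * ∑ u, p x y * a x u * confusion (fun v => S v y) G u) :=
        Finset.sum_le_sum fun x _ => Finset.sum_le_sum fun y _ => key x y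
    _ = _ := by
        simp_rw [Finset.sum_add_distrib, ← Finset.mul_sum]

/-- One-shot coding theorem: `α` controls the covering rate of the selected codewords, `β` the
reliability of the decoder, `θ` the selection probability, `η` a slack. -/
theorem exists_code_one_shot {U X Y Z : Type*} [Fintype U] [Fintype X] [Fintype Y]
    [Fintype Z] [Nonempty U] {M : ℕ} (hM : 0 < M) {θ : ℝ} (h0 : 0 < θ) (h1 : θ ≤ 1)
    {α β η : ℝ} (hα : 0 ≤ α) (hβ : 0 < β) (hη : 0 < η)
    {p : X → Y → ℝ} (hp : ∀ x y, 0 ≤ p x y) (hp1 : ∑ x, ∑ y, p x y = 1)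
    {a : X → U → ℝ} (ha : ∀ x, IsPMF (a x))
    {b : U → Y → Z → ℝ} (hb : ∀ u y, IsPMF (b u y)) :
    ∃ enc : X → Fin M → ℝ, ∃ dec : Fin M → Y → Z → ℝ,
      (∀ x, IsPMF (enc x)) ∧ (∀ m y, IsPMF (dec m y)) ∧
      ∑ x, ∑ y, ∑ z, |p x y * (∑ m, enc x m * dec m y z) - ∑ u, p x y * a x u * b u y z|
        ≤ 2 * ((η + α * ((1 - θ) / θ) / η)
            + 2 * ∑ x, ∑ y, ∑ z, ∑ u,
              if α * ∑ v, p x y * a x v * b v y z < p x y * a x u * b u y z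
                then p x y * a x u * b u y z else 0)
          + 2 * ((∑ y, ∑ u, if ∑ x, p x y * a x u < β * ∑ x, p x y
              then ∑ x, p x y * a x u else 0) + θ / (M * β)) := by
  have hw := selLaw_isPMF hM h0 h1
  have hW : IsPMF (fun G : U → Option (Fin M) => ∏ i, selLaw M θ (G i)) := IsPMF.pi fun _ => hw
  have hMpos : (0 : ℝ) < M := by exact_mod_cast hM
  obtain ⟨S, hS⟩ : ∃ S : U → Y → Prop,
      ∀ u y, S u y ↔ β * ∑ x, p x y ≤ ∑ x, p x y * a x u := ⟨_, fun _ _ => Iff.rfl⟩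
  set E : (U → Option (Fin M)) → ℝ := fun G =>
    2 * ∑ x, ∑ y, ∑ z, |∑ u, (sel (G u) / θ - 1) * (p x y * a x u * b u y z)|
      + 2 / θ * ∑ x, ∑ y, ∑ u, p x y * a x u * confusion (fun v => S v y) G u with hE
  suffices hmean : ∑ G, (∏ i, selLaw M θ (G i)) * E G ≤
      2 * ((η + α * ((1 - θ) / θ) / η)
            + 2 * ∑ x, ∑ y, ∑ z, ∑ u,
              if α * ∑ v, p x y * a x v * b v y z < p x y * a x u * b u y z
                then p x y * a x u * b u y z else 0)
          + 2 * ((∑ y, ∑ u, if ∑ x, p x y * a x u < β * ∑ x, p x y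
              then ∑ x, p x y * a x u else 0) + θ / (M * β)) by
    obtain ⟨G, hG⟩ := hW.exists_le E hmean
    obtain ⟨enc, dec, he, hd, hle⟩ := exists_code_of_selection hM h0 hp ha hb S G
    exact ⟨enc, dec, he, hd, hle.trans hG⟩
  have hpa : ∀ x y u, 0 ≤ p x y * a x u := fun x y u => mul_nonneg (hp x y) ((ha x).1 u)
  have hpab : ∀ x y z u, 0 ≤ p x y * a x u * b u y z := fun x y z u =>
    mul_nonneg (hpa x y u) ((hb u y).1 z)
  have hcov : ∑ G : U → Option (Fin M), (∏ i, selLaw M θ (G i)) *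
      (∑ x, ∑ y, ∑ z, |∑ u, (sel (G u) / θ - 1) * (p x y * a x u * b u y z)|)
      ≤ (η + α * ((1 - θ) / θ) / η) + 2 * ∑ x, ∑ y, ∑ z, ∑ u,
              if α * ∑ v, p x y * a x v * b v y z < p x y * a x u * b u y z
                then p x y * a x u * b u y z else 0 := by
    have htot : ∑ x, ∑ y, ∑ z, ∑ u, p x y * a x u * b u y z = 1 := by
      rw [← hp1]
      refine Finset.sum_congr rfl fun x _ => Finset.sum_congr rfl fun y _ => ?_
      rw [Finset.sum_comm]
      simp_rw [← Finset.mul_sum, (hb _ _).2, mul_one, ← Finset.mul_sum, (ha _).2, mul_one]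
    calc _ = ∑ x, ∑ y, ∑ z, ∑ G : U → Option (Fin M), (∏ i, selLaw M θ (G i)) *
          |∑ u, (sel (G u) / θ - 1) * (p x y * a x u * b u y z)| := by
          simp_rw [Finset.mul_sum (s := (Finset.univ : Finset X)),
            Finset.mul_sum (s := (Finset.univ : Finset Y)),
            Finset.mul_sum (s := (Finset.univ : Finset Z))]
          rw [Finset.sum_comm]
          refine Finset.sum_congr rfl fun x _ => ?_
          rw [Finset.sum_comm]
          refine Finset.sum_congr rfl fun y _ => ?_
          rw [Finset.sum_comm]
      _ ≤ ∑ x, ∑ y, ∑ z, ((η + α * ((1 - θ) / θ) / η) * ∑ u, p x y * a x u * b u y z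
          + 2 * ∑ u, if α * ∑ v, p x y * a x v * b v y z < p x y * a x u * b u y z
                then p x y * a x u * b u y z else 0) := by
          refine Finset.sum_le_sum fun x _ => Finset.sum_le_sum fun y _ =>
            Finset.sum_le_sum fun z _ => ?_
          exact soft_covering hM h0 h1 hα hη (fun u => p x y * a x u * b u y z) (hpab x y z)
      _ = _ := by
          simp_rw [Finset.sum_add_distrib, ← Finset.mul_sum]
          rw [htot, mul_one]
  have hcard : ∀ y, (∑ x, p x y) * ∑ v, (if S v y then (1 : ℝ) else 0) ≤ (∑ x, p x y) / β := by
    intro y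
    have hpy : 0 ≤ ∑ x, p x y := Finset.sum_nonneg fun x _ => hp x y
    rw [le_div_iff₀ hβ, Finset.mul_sum, Finset.sum_mul]
    calc _ ≤ ∑ v, ∑ x, p x y * a x v := by
          refine Finset.sum_le_sum fun v _ => ?_
          by_cases h : S v y
          · simp only [h, if_true, mul_one]
            rw [mul_comm]
            exact (hS v y).1 h
          · simp only [h, if_false, mul_zero, zero_mul]
            exact Finset.sum_nonneg fun x _ => hpa x y v
      _ = _ := by
          rw [Finset.sum_comm]
          simp_rw [← Finset.mul_sum, (ha _).2, mul_one]
  have hcon : ∑ G : U → Option (Fin M), (∏ i, selLaw M θ (G i)) *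
      (∑ x, ∑ y, ∑ u, p x y * a x u * confusion (fun v => S v y) G u)
      ≤ θ * ((∑ y, ∑ u, if ∑ x, p x y * a x u < β * ∑ x, p x y
              then ∑ x, p x y * a x u else 0) + θ / (M * β)) := by
    calc _ = ∑ x, ∑ y, ∑ u, p x y * a x u * ∑ G : U → Option (Fin M),
            (∏ i, selLaw M θ (G i)) * confusion (fun v => S v y) G u := by
          simp_rw [Finset.mul_sum (s := (Finset.univ : Finset X)),
            Finset.mul_sum (s := (Finset.univ : Finset Y)),
            Finset.mul_sum (s := (Finset.univ : Finset U))]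
          rw [Finset.sum_comm]
          refine Finset.sum_congr rfl fun x _ => ?_
          rw [Finset.sum_comm]
          refine Finset.sum_congr rfl fun y _ => ?_
          rw [Finset.sum_comm]
          refine Finset.sum_congr rfl fun u _ => ?_
          rw [Finset.mul_sum]
          exact Finset.sum_congr rfl fun G _ => by ring
      _ ≤ ∑ x, ∑ y, ∑ u, p x y * a x u *
            (θ * ((if S u y then 0 else 1) + θ / M * ∑ v, if S v y then 1 else 0)) := by
          refine Finset.sum_le_sum fun x _ => Finset.sum_le_sum fun y _ =>
            Finset.sum_le_sum fun u _ => mul_le_mul_of_nonneg_left ?_ (hpa x y u)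
          exact sum_selLaw_mul_confusion_le hM h0 h1 (fun v => S v y) u
      _ = θ * (∑ y, ((∑ u, (∑ x, p x y * a x u) * (if S u y then 0 else 1))
            + θ / M * ((∑ x, p x y) * ∑ v, if S v y then 1 else 0))) := by
          rw [Finset.sum_comm, Finset.mul_sum]
          refine Finset.sum_congr rfl fun y _ => ?_
          have e : ∑ x, p x y = ∑ u, ∑ x, p x y * a x u := by
            rw [Finset.sum_comm]
            simp_rw [← Finset.mul_sum, (ha _).2, mul_one]
          rw [Finset.sum_comm, e]
          generalize (∑ v, if S v y then (1 : ℝ) else 0) = K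
          rw [Finset.sum_mul, Finset.mul_sum, ← Finset.sum_add_distrib, Finset.mul_sum]
          refine Finset.sum_congr rfl fun u _ => ?_
          rw [← Finset.sum_mul]
          ring
      _ ≤ θ * (∑ y, ((∑ u, if ∑ x, p x y * a x u < β * ∑ x, p x y
              then ∑ x, p x y * a x u else 0) + θ / M * ((∑ x, p x y) / β))) := by
          refine mul_le_mul_of_nonneg_left (Finset.sum_le_sum fun y _ => add_le_add
            (Finset.sum_le_sum fun u _ => ?_) ?_) h0.le
          · by_cases h : S u y
            · have h' : ¬ (∑ x, p x y * a x u < β * ∑ x, p x y) := not_lt.2 ((hS u y).1 h)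
              simp [h, h']
            · have h' : ∑ x, p x y * a x u < β * ∑ x, p x y := not_le.1 (mt (hS u y).2 h)
              simp [h, h']
          · exact mul_le_mul_of_nonneg_left (hcard y) (by positivity)
      _ = _ := by
          have hp2 : ∑ y, ∑ x, p x y = 1 := by rw [Finset.sum_comm]; exact hp1
          rw [Finset.sum_add_distrib, ← Finset.mul_sum, ← Finset.sum_div, hp2]
          field_simp
  calc _ = 2 * (∑ G : U → Option (Fin M), (∏ i, selLaw M θ (G i)) *
          (∑ x, ∑ y, ∑ z, |∑ u, (sel (G u) / θ - 1) * (p x y * a x u * b u y z)|))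
        + 2 / θ * (∑ G : U → Option (Fin M), (∏ i, selLaw M θ (G i)) *
          (∑ x, ∑ y, ∑ u, p x y * a x u * confusion (fun v => S v y) G u)) := by
        rw [Finset.mul_sum, Finset.mul_sum, ← Finset.sum_add_distrib]
        exact Finset.sum_congr rfl fun G _ => by simp only [hE]; ring
    _ ≤ _ := by
        refine add_le_add (mul_le_mul_of_nonneg_left hcov (by norm_num)) ?_
        refine (mul_le_mul_of_nonneg_left hcon (by positivity)).trans (le_of_eq ?_)
        field_simp

/-- Exponential Markov bound: a product of i.i.d. positive variables with negative mean logarithm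
is at least `1` with vanishing probability. -/
theorem eventually_sum_pi_ite_le {Ω : Type*} [Fintype Ω] {p : Ω → ℝ} (hp : IsPMF p) (r : Ω → ℝ)
    (hr : ∀ w, 0 < p w → 0 < r w) (hlog : ∑ w, p w * Real.log (r w) < 0) {ε : ℝ} (hε : 0 < ε) :
    ∃ N : ℕ, ∀ n ≥ N,
      ∑ w : Fin n → Ω, (if 1 ≤ ∏ i, r (w i) then ∏ i, p (w i) else 0) ≤ ε := by
  set s : Ω → ℝ := fun w => if 0 < p w then r w else 1 with hs
  have hs0 : ∀ w, 0 < s w := by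
    intro w; simp only [hs]; split_ifs with h; exacts [hr w h, one_pos]
  set φ : ℝ → ℝ := fun t => ∑ w, p w * Real.exp (t * Real.log (s w)) with hφ
  have hderiv : HasDerivAt φ (∑ w, p w * Real.log (r w)) 0 := by
    have h : ∀ w ∈ (Finset.univ : Finset Ω),
        HasDerivAt (fun t : ℝ => p w * Real.exp (t * Real.log (s w)))
          (p w * (Real.exp (0 * Real.log (s w)) * (1 * Real.log (s w)))) 0 := fun w _ =>
      (((hasDerivAt_id (0 : ℝ)).mul_const _).exp).const_mul _
    have e : ∑ w, p w * Real.log (r w)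
        = ∑ w, p w * (Real.exp (0 * Real.log (s w)) * (1 * Real.log (s w))) := by
      refine Finset.sum_congr rfl fun w _ => ?_
      rcases (hp.1 w).eq_or_lt with h | h
      · simp [← h]
      · simp [hs, h]
    rw [e]
    exact HasDerivAt.fun_sum h
  have hφ0 : φ 0 = 1 := by simp [hφ, hp.2]
  obtain ⟨t, ht0, ht1⟩ : ∃ t : ℝ, 0 < t ∧ φ t < 1 := by
    have h1 := (hasDerivAt_iff_tendsto_slope.1 hderiv).eventually (gt_mem_nhds hlog)
    have h2 : ∀ᶠ t in nhdsWithin (0 : ℝ) (Set.Ioi 0), slope φ 0 t < 0 :=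
      h1.filter_mono (nhdsWithin_mono _ fun x hx => ne_of_gt hx)
    obtain ⟨t, ht, htp⟩ := (h2.and self_mem_nhdsWithin).exists
    refine ⟨t, htp, ?_⟩
    have htp' : (0 : ℝ) < t := htp
    rw [slope_def_field, sub_zero, hφ0, div_neg_iff] at ht
    rcases ht with h | h <;> linarith [h.1, h.2]
  have hφn : 0 ≤ φ t := Finset.sum_nonneg fun w _ => mul_nonneg (hp.1 w) (Real.exp_pos _).le
  obtain ⟨N, hN⟩ := exists_pow_lt_of_lt_one hε ht1
  refine ⟨N, fun n hn => ?_⟩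
  calc _ ≤ ∑ w : Fin n → Ω, ∏ i, p (w i) * Real.exp (t * Real.log (s (w i))) := by
        refine Finset.sum_le_sum fun w _ => ?_
        have hpos : 0 ≤ ∏ i, p (w i) * Real.exp (t * Real.log (s (w i))) :=
          Finset.prod_nonneg fun i _ => mul_nonneg (hp.1 _) (Real.exp_pos _).le
        split_ifs with h
        swap
        · exact hpos
        by_cases hz : ∃ i, p (w i) = 0
        · obtain ⟨i, hi⟩ := hz
          rw [Finset.prod_eq_zero (Finset.mem_univ i) hi]
          exact hpos
        · push Not at hz
          have hsr : ∀ i, s (w i) = r (w i) := fun i => by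
            simp [hs, lt_of_le_of_ne (hp.1 (w i)) (Ne.symm (hz i))]
          rw [Finset.prod_mul_distrib, ← Real.exp_sum, ← Finset.mul_sum,
            ← Real.log_prod (fun i _ => (hs0 (w i)).ne')]
          refine le_mul_of_one_le_right (Finset.prod_nonneg fun i _ => hp.1 _) ?_
          rw [Real.one_le_exp_iff]
          refine mul_nonneg ht0.le (Real.log_nonneg ?_)
          simpa only [hsr] using h
    _ = φ t ^ n := by
        refine (sum_prod_pi (fun _ w => p w * Real.exp (t * Real.log (s w)))).trans ?_
        simp [hφ]
    _ ≤ φ t ^ N := pow_le_pow_of_le_one hφn ht1.le hn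
    _ ≤ ε := hN.le

/-- If `q ≥ 0` dominates `p` and the relative entropy rate `∑ p log (p / q)` is below `log α`,
then `p ^ n` exceeds `α ^ n q ^ n` with vanishing probability. -/
theorem eventually_sum_pi_upper {Ω : Type*} [Fintype Ω] {p q : Ω → ℝ} (hp : IsPMF p)
    (hq : ∀ w, 0 < p w → 0 < q w) {l : ℝ}
    (hl : ∑ w, p w * Real.log (p w / q w) < l) {ε : ℝ} (hε : 0 < ε) :
    ∃ N : ℕ, ∀ n ≥ N, ∑ w : Fin n → Ω,
      (if Real.exp (n * l) * ∏ i, q (w i) < ∏ i, p (w i) then ∏ i, p (w i) else 0) ≤ ε := by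
  obtain ⟨N, hN⟩ := eventually_sum_pi_ite_le hp (fun w => p w / q w / Real.exp l)
    (fun w hw => div_pos (div_pos hw (hq w hw)) (Real.exp_pos l)) (by
      have : ∀ w, p w * Real.log (p w / q w / Real.exp l)
          = p w * Real.log (p w / q w) - p w * l := by
        intro w
        rcases (hp.1 w).eq_or_lt with h | h
        · simp [← h]
        · rw [Real.log_div (div_pos h (hq w h)).ne' (Real.exp_pos l).ne', Real.log_exp]
          ring
      simp_rw [this]
      rw [Finset.sum_sub_distrib, ← Finset.sum_mul, hp.2]
      linarith) hε
  refine ⟨N, fun n hn => (Finset.sum_le_sum fun w _ => ?_).trans (hN n hn)⟩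
  by_cases hz : ∃ i, p (w i) = 0
  · obtain ⟨i, hi⟩ := hz
    have hz : ∏ i, p (w i) = 0 := Finset.prod_eq_zero (Finset.mem_univ i) hi
    simp only [hz, ite_self, le_refl]
  · push Not at hz
    have hpw : ∀ i, 0 < p (w i) := fun i => lt_of_le_of_ne (hp.1 (w i)) (Ne.symm (hz i))
    have hqw : 0 < ∏ i, q (w i) := Finset.prod_pos fun i _ => hq _ (hpw i)
    have hP : 0 ≤ ∏ i, p (w i) := Finset.prod_nonneg fun i _ => hp.1 _
    have e : ∏ i, p (w i) / q (w i) / Real.exp l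
        = (∏ i, p (w i)) / (Real.exp (n * l) * ∏ i, q (w i)) := by
      rw [Finset.prod_div_distrib, Finset.prod_div_distrib, Finset.prod_const, Finset.card_univ,
        Fintype.card_fin, ← Real.exp_nat_mul, div_div, mul_comm]
    split_ifs with h1 h2 h2
    · exact le_rfl
    · refine absurd ?_ h2
      rw [e, one_le_div (mul_pos (Real.exp_pos _) hqw)]
      exact h1.le
    · exact hP
    · exact le_rfl

/-- If `q > 0` on the support of `p` and the relative entropy rate `∑ p log (p / q)` exceeds
`log β`, then `p ^ n` is below `β ^ n q ^ n` with vanishing probability. -/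
theorem eventually_sum_pi_lower {Ω : Type*} [Fintype Ω] {p q : Ω → ℝ} (hp : IsPMF p)
    (hq : ∀ w, 0 < p w → 0 < q w) {l : ℝ}
    (hl : l < ∑ w, p w * Real.log (p w / q w)) {ε : ℝ} (hε : 0 < ε) :
    ∃ N : ℕ, ∀ n ≥ N, ∑ w : Fin n → Ω,
      (if ∏ i, p (w i) < Real.exp (n * l) * ∏ i, q (w i) then ∏ i, p (w i) else 0) ≤ ε := by
  obtain ⟨N, hN⟩ := eventually_sum_pi_ite_le hp (fun w => (p w / q w / Real.exp l)⁻¹)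
    (fun w hw => inv_pos.2 (div_pos (div_pos hw (hq w hw)) (Real.exp_pos l))) (by
      have : ∀ w, p w * Real.log (p w / q w / Real.exp l)⁻¹
          = p w * l - p w * Real.log (p w / q w) := by
        intro w
        rcases (hp.1 w).eq_or_lt with h | h
        · simp [← h]
        · rw [Real.log_inv, Real.log_div (div_pos h (hq w h)).ne' (Real.exp_pos l).ne',
            Real.log_exp]
          ring
      simp_rw [this]
      rw [Finset.sum_sub_distrib, ← Finset.sum_mul, hp.2]
      linarith) hε
  refine ⟨N, fun n hn => (Finset.sum_le_sum fun w _ => ?_).trans (hN n hn)⟩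
  by_cases hz : ∃ i, p (w i) = 0
  · obtain ⟨i, hi⟩ := hz
    have hz : ∏ i, p (w i) = 0 := Finset.prod_eq_zero (Finset.mem_univ i) hi
    simp only [hz, ite_self, le_refl]
  · push Not at hz
    have hpw : ∀ i, 0 < p (w i) := fun i => lt_of_le_of_ne (hp.1 (w i)) (Ne.symm (hz i))
    have hP : 0 < ∏ i, p (w i) := Finset.prod_pos fun i _ => hpw i
    have e : ∏ i, (p (w i) / q (w i) / Real.exp l)⁻¹
        = (Real.exp (n * l) * ∏ i, q (w i)) / (∏ i, p (w i)) := by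
      rw [Finset.prod_inv_distrib, Finset.prod_div_distrib, Finset.prod_div_distrib,
        Finset.prod_const, Finset.card_univ, Fintype.card_fin, ← Real.exp_nat_mul, div_div,
        mul_comm, inv_div]
    split_ifs with h1 h2 h2
    · exact le_rfl
    · refine absurd ?_ h2
      rw [e, one_le_div hP]
      exact h1.le
    · exact hP.le
    · exact le_rfl

/-- Mass of the pushforward of `p` along `f` at the point `b`. -/
noncomputable def mass {Ω β : Type*} [Fintype Ω] (p : Ω → ℝ) (f : Ω → β) (b : β) : ℝ :=
  ∑ w, if f w = b then p w else 0

theorem mass_nonneg {Ω β : Type*} [Fintype Ω] {p : Ω → ℝ} (hp : ∀ w, 0 ≤ p w) (f : Ω → β)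
    (b : β) : 0 ≤ mass p f b :=
  Finset.sum_nonneg fun w _ => by split_ifs; exacts [hp w, le_rfl]

theorem mass_le_mass {Ω β γ : Type*} [Fintype Ω] {p : Ω → ℝ} (hp : ∀ w, 0 ≤ p w) (f : Ω → β)
    (g : Ω → γ) (b : β) (c : γ) (h : ∀ w, f w = b → g w = c) : mass p f b ≤ mass p g c := by
  refine Finset.sum_le_sum fun w _ => ?_
  by_cases hf : f w = b
  · simp [hf, h w hf]
  · simp only [hf, if_false]
    split_ifs
    exacts [hp w, le_rfl]

theorem mass_congr {Ω β γ : Type*} [Fintype Ω] (p : Ω → ℝ) (f : Ω → β)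
    (g : Ω → γ) (b : β) (c : γ) (h : ∀ w, f w = b ↔ g w = c) : mass p f b = mass p g c := by
  simp only [mass, h]

theorem sum_mass_mul {Ω β : Type*} [Fintype Ω] [Fintype β] (p : Ω → ℝ) (f : Ω → β)
    (g : β → ℝ) : ∑ b, mass p f b * g b = ∑ w, p w * g (f w) := by
  simp only [mass, Finset.sum_mul]
  rw [Finset.sum_comm]
  simp

theorem sum_mass_prod_left {Ω α β : Type*} [Fintype Ω] [Fintype α] (p : Ω → ℝ) (f : Ω → α)
    (g : Ω → β) (b : β) : ∑ a, mass p (fun w => (f w, g w)) (a, b) = mass p g b := by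
  simp only [mass]
  rw [Finset.sum_comm]
  simp [Prod.mk.injEq, ite_and]

theorem sum_mass_prod_right {Ω α β : Type*} [Fintype Ω] [Fintype β] (p : Ω → ℝ) (f : Ω → α)
    (g : Ω → β) (a : α) : ∑ b, mass p (fun w => (f w, g w)) (a, b) = mass p f a := by
  simp only [mass]
  rw [Finset.sum_comm]
  refine Finset.sum_congr rfl fun w _ => ?_
  by_cases h : f w = a <;> simp [h]

theorem Hof_mul_log_two {Ω β : Type*} [Fintype Ω] (p : Ω → ℝ) (f : Ω → β) :
    Hof p f * Real.log 2 = -∑ w, p w * Real.log (mass p f (f w)) := by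
  have h2 : Real.log 2 ≠ 0 := (Real.log_pos one_lt_two).ne'
  rw [Hof, div_mul_cancel₀ _ h2, ← Finset.sum_neg_distrib,
    ← Finset.sum_fiberwise_of_maps_to (s := Finset.univ) (t := Finset.univ.image f) (g := f)
      (fun w hw => Finset.mem_image_of_mem f hw)]
  refine Finset.sum_congr rfl fun b _ => ?_
  have hm : ∑ a ∈ Finset.univ.filter (fun a => f a = b), p a = mass p f b := by
    rw [mass, Finset.sum_filter]
  rw [hm, Real.negMulLog, ← hm, neg_mul, Finset.sum_mul, ← Finset.sum_neg_distrib, hm]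
  refine Finset.sum_congr rfl fun a ha => ?_
  rw [(Finset.mem_filter.1 ha).2]

theorem cmi_mul_log_two {Ω α β γ : Type*} [Fintype Ω] (p : Ω → ℝ)
    (A : Ω → α) (B : Ω → β) (C : Ω → γ) :
    cmi p A B C * Real.log 2 = ∑ w, p w *
      (Real.log (mass p (fun w => (A w, B w, C w)) (A w, B w, C w)) + Real.log (mass p B (B w))
        - Real.log (mass p (fun w => (A w, B w)) (A w, B w))
        - Real.log (mass p (fun w => (B w, C w)) (B w, C w))) := by
  rw [cmi, sub_mul, sub_mul, add_mul, Hof_mul_log_two, Hof_mul_log_two, Hof_mul_log_two,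
    Hof_mul_log_two]
  simp_rw [mul_sub, mul_add]
  rw [Finset.sum_sub_distrib, Finset.sum_sub_distrib, Finset.sum_add_distrib]
  ring

/-- Gibbs' inequality for one term, with its equality case. -/
theorem sub_le_mul_log_sub_log {q r : ℝ} (hq : 0 < q) (hr : 0 < r) :
    q - r ≤ q * (Real.log q - Real.log r) ∧
      (q * (Real.log q - Real.log r) = q - r → q = r) := by
  have hd : 0 < r / q := div_pos hr hq
  have e : Real.log q - Real.log r = - Real.log (r / q) := by
    rw [Real.log_div hr.ne' hq.ne']; ring
  have e2 : q * (r / q - 1) = r - q := by field_simp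
  rw [e]
  refine ⟨?_, fun h => ?_⟩
  · have := mul_le_mul_of_nonneg_left (Real.log_le_sub_one_of_pos hd) hq.le
    linarith
  · by_contra hne
    have h1 : r / q ≠ 1 := fun h1 => hne (div_eq_one_iff_eq hq.ne' |>.1 h1).symm
    have := mul_lt_mul_of_pos_left (Real.log_lt_sub_one_of_pos hd h1) hq
    linarith

/-- Conditional mutual information is nonnegative and vanishes only under conditional
independence. -/
theorem cmi_nonneg_and_eq_zero {Ω α β γ : Type*} [Fintype Ω] [Fintype α] [Fintype β] [Fintype γ]
    {p : Ω → ℝ} (hp : ∀ w, 0 ≤ p w) (A : Ω → α) (B : Ω → β) (C : Ω → γ) :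
    0 ≤ cmi p A B C ∧ (cmi p A B C = 0 → ∀ a b c,
      mass p (fun w => (A w, B w, C w)) (a, b, c) * mass p B b
        = mass p (fun w => (A w, B w)) (a, b) * mass p (fun w => (B w, C w)) (b, c)) := by
  set q := mass p (fun w => (A w, B w, C w)) with hq
  set mB := mass p B with hmB
  set mAB := mass p (fun w => (A w, B w)) with hmAB
  set mBC := mass p (fun w => (B w, C w)) with hmBC
  have hq0 : ∀ t, 0 ≤ q t := fun t => mass_nonneg hp _ _
  have hB0 : ∀ t, 0 ≤ mB t := fun t => mass_nonneg hp _ _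
  have hAB0 : ∀ t, 0 ≤ mAB t := fun t => mass_nonneg hp _ _
  have hBC0 : ∀ t, 0 ≤ mBC t := fun t => mass_nonneg hp _ _
  have hqAB : ∀ a b c, q (a, b, c) ≤ mAB (a, b) := fun a b c =>
    mass_le_mass hp _ _ _ _ fun w h => by simp only [Prod.mk.injEq] at h ⊢; exact ⟨h.1, h.2.1⟩
  have hqBC : ∀ a b c, q (a, b, c) ≤ mBC (b, c) := fun a b c =>
    mass_le_mass hp _ _ _ _ fun w h => by simp only [Prod.mk.injEq] at h ⊢; exact h.2
  have hABB : ∀ a b, mAB (a, b) ≤ mB b := fun a b =>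
    mass_le_mass hp _ _ _ _ fun w h => by simp only [Prod.mk.injEq] at h; exact h.2
  set r : α × β × γ → ℝ := fun t => mAB (t.1, t.2.1) * mBC (t.2.1, t.2.2) / mB t.2.1 with hr
  have hr0 : ∀ t, 0 ≤ r t := fun t => div_nonneg (mul_nonneg (hAB0 _) (hBC0 _)) (hB0 _)
  set L : α × β × γ → ℝ := fun t => q t * (Real.log (q t) + Real.log (mB t.2.1)
    - Real.log (mAB (t.1, t.2.1)) - Real.log (mBC (t.2.1, t.2.2))) with hL
  have hcmi : cmi p A B C * Real.log 2 = ∑ t, L t := by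
    rw [cmi_mul_log_two]
    exact (sum_mass_mul p (fun w => (A w, B w, C w)) (fun t => Real.log (q t)
      + Real.log (mB t.2.1) - Real.log (mAB (t.1, t.2.1)) - Real.log (mBC (t.2.1, t.2.2)))).symm
  have hterm : ∀ t, q t - r t ≤ L t ∧ (L t = q t - r t → q t = r t) := by
    rintro ⟨a, b, c⟩
    rcases (hq0 (a, b, c)).eq_or_lt with h | h
    · have hL0 : L (a, b, c) = 0 := by simp [hL, ← h]
      rw [hL0, ← h]
      exact ⟨by linarith [hr0 (a, b, c)], fun h' => by linarith⟩
    · have h1 : 0 < mAB (a, b) := h.trans_le (hqAB a b c)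
      have h2 : 0 < mBC (b, c) := h.trans_le (hqBC a b c)
      have h3 : 0 < mB b := h1.trans_le (hABB a b)
      have hrp : 0 < r (a, b, c) := div_pos (mul_pos h1 h2) h3
      have e : L (a, b, c) = q (a, b, c) * (Real.log (q (a, b, c)) - Real.log (r (a, b, c))) := by
        simp only [hL, hr]
        rw [Real.log_div (mul_pos h1 h2).ne' h3.ne', Real.log_mul h1.ne' h2.ne']
        ring
      rw [e]
      exact sub_le_mul_log_sub_log h hrp
  have hsumq : ∑ t, q t = ∑ w, p w := by
    have := sum_mass_mul p (fun w => (A w, B w, C w)) (fun _ => 1)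
    simpa using this
  have hsumB : ∑ b, mB b = ∑ w, p w := by
    have := sum_mass_mul p B (fun _ => 1)
    simpa using this
  have hsumr : ∑ t, r t = ∑ w, p w := by
    rw [← hsumB, Fintype.sum_prod_type]
    simp_rw [Fintype.sum_prod_type]
    rw [Finset.sum_comm]
    refine Finset.sum_congr rfl fun b _ => ?_
    simp only [hr]
    simp_rw [← Finset.sum_div, ← Finset.mul_sum]
    have e1 : ∑ c, mBC (b, c) = mB b := sum_mass_prod_right p B C b
    have e2 : ∑ a, mAB (a, b) = mB b := sum_mass_prod_left p A B b
    rw [e1, ← Finset.sum_mul, e2, mul_self_div_self]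
  have hdiff : ∑ t, (q t - r t) = 0 := by
    rw [Finset.sum_sub_distrib, hsumq, hsumr, sub_self]
  have hl2 : 0 < Real.log 2 := Real.log_pos one_lt_two
  refine ⟨?_, fun h0 a b c => ?_⟩
  · have : 0 ≤ cmi p A B C * Real.log 2 := by
      rw [hcmi, ← hdiff]
      exact Finset.sum_le_sum fun t _ => (hterm t).1
    exact nonneg_of_mul_nonneg_left this hl2
  · rw [h0, zero_mul] at hcmi
    have hall := (Finset.sum_eq_sum_iff_of_le (fun t _ => (hterm t).1)).1 (hdiff.trans hcmi)
    have he := (hterm (a, b, c)).2 (hall (a, b, c) (Finset.mem_univ _)).symm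
    rw [he]
    simp only [hr]
    by_cases hz : mB b = 0
    · have : mAB (a, b) = 0 := le_antisymm ((hABB a b).trans hz.le) (hAB0 _)
      simp [hz, this]
    · field_simp

theorem sum_pi_prod₄ {ι A B C D : Type*} [Fintype ι] [DecidableEq ι] [Fintype A] [Fintype B]
    [Fintype C] [Fintype D] (F : (ι → A) → (ι → B) → (ι → C) → (ι → D) → ℝ) :
    ∑ x, ∑ y, ∑ z, ∑ u, F x y z u = ∑ w : ι → A × B × C × D,
      F (fun i => (w i).1) (fun i => (w i).2.1) (fun i => (w i).2.2.1)
        (fun i => (w i).2.2.2) := by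
  have e : ∀ x, ∑ y, ∑ z, ∑ u, F x y z u = ∑ w : ι → B × C × D,
      F x (fun i => (w i).1) (fun i => (w i).2.1) (fun i => (w i).2.2) := fun x =>
    (Finset.sum_congr rfl fun y _ => sum_pi_prod (F x y)).trans
      (sum_pi_prod fun (y : ι → B) (w : ι → C × D) =>
        F x y (fun i => (w i).1) (fun i => (w i).2))
  exact (Finset.sum_congr rfl fun x _ => e x).trans
    (sum_pi_prod fun (x : ι → A) (w : ι → B × C × D) =>
      F x (fun i => (w i).1) (fun i => (w i).2.1) (fun i => (w i).2.2))

theorem msgCard_pos (n : ℕ) (R : ℝ) : 0 < msgCard n R :=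
  Nat.ceil_pos.2 (Real.rpow_pos_of_pos two_pos _)

theorem exp_le_msgCard (n : ℕ) (R : ℝ) : Real.exp (n * (R * Real.log 2)) ≤ msgCard n R := by
  refine le_trans (le_of_eq ?_) (Nat.le_ceil ((2 : ℝ) ^ ((n : ℝ) * R)))
  rw [Real.rpow_def_of_pos two_pos]
  congr 1
  ring

/-- Block coding theorem for a factorized single-letter law: rates above the difference of the
two relative entropy rates suffice. -/
theorem eventually_exists_code {U X Y Z : Type*} [Fintype U] [Fintype X] [Fintype Y]
    [Fintype Z] [Nonempty U] {p : X × Y → ℝ} (hp : IsPMF p)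
    {a : X → U → ℝ} (ha : ∀ x, IsPMF (a x)) {b : U → Y → Z → ℝ} (hb : ∀ u y, IsPMF (b u y))
    {R : ℝ}
    (hR : (∑ x, ∑ y, ∑ z, ∑ u, p (x, y) * a x u * b u y z * Real.log (p (x, y) * a x u * b u y z
          / ∑ v, p (x, y) * a x v * b v y z))
        - (∑ y, ∑ u, (∑ x, p (x, y) * a x u) * Real.log ((∑ x, p (x, y) * a x u)
          / ∑ x, p (x, y))) < R * Real.log 2)
    {ε : ℝ} (hε : 0 < ε) :
    ∃ N : ℕ, ∀ n ≥ N, ∃ enc : (Fin n → X) → Fin (msgCard n R) → ℝ,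
      ∃ dec : Fin (msgCard n R) → (Fin n → Y) → (Fin n → Z) → ℝ,
      (∀ x, IsPMF (enc x)) ∧ (∀ m y, IsPMF (dec m y)) ∧
      ∑ x, ∑ y, ∑ z, |(∏ i, p (x i, y i)) * (∑ m, enc x m * dec m y z)
        - ∏ i, ∑ u, p (x i, y i) * a (x i) u * b u (y i) (z i)| ≤ ε := by
  set P : X × Y × Z × U → ℝ := fun w => p (w.1, w.2.1) * a w.1 w.2.2.2 * b w.2.2.2 w.2.1 w.2.2.1
    with hP
  set PV : X × Y × Z × U → ℝ := fun w => ∑ v, p (w.1, w.2.1) * a w.1 v * b v w.2.1 w.2.2.1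
    with hPV
  set T : Y × U → ℝ := fun w => ∑ x, p (x, w.1) * a x w.2 with hT
  set TY : Y × U → ℝ := fun w => ∑ x, p (x, w.1) with hTY
  set A := ∑ x, ∑ y, ∑ z, ∑ u, p (x, y) * a x u * b u y z * Real.log (p (x, y) * a x u * b u y z
          / ∑ v, p (x, y) * a x v * b v y z) with hA
  set B := ∑ y, ∑ u, (∑ x, p (x, y) * a x u) * Real.log ((∑ x, p (x, y) * a x u)
          / ∑ x, p (x, y)) with hB
  have hAP : ∑ w, P w * Real.log (P w / PV w) = A := by
    simp only [Fintype.sum_prod_type, hP, hPV, hA]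
  have hBT : ∑ w, T w * Real.log (T w / TY w) = B := by
    simp only [Fintype.sum_prod_type, hT, hTY, hB]
  have hpa : ∀ x y u, 0 ≤ p (x, y) * a x u := fun x y u => mul_nonneg (hp.1 _) ((ha x).1 u)
  have hpab : ∀ x y z u, 0 ≤ p (x, y) * a x u * b u y z := fun x y z u =>
    mul_nonneg (hpa x y u) ((hb u y).1 z)
  have hp1 : ∑ x, ∑ y, p (x, y) = 1 := by rw [← hp.2, Fintype.sum_prod_type]
  have hPpmf : IsPMF P := by
    refine ⟨fun w => hpab _ _ _ _, ?_⟩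
    simp only [Fintype.sum_prod_type, hP]
    rw [← hp1]
    refine Finset.sum_congr rfl fun x _ => Finset.sum_congr rfl fun y _ => ?_
    rw [Finset.sum_comm]
    simp_rw [← Finset.mul_sum, (hb _ _).2, mul_one, ← Finset.mul_sum, (ha _).2, mul_one]
  have hTpmf : IsPMF T := by
    refine ⟨fun w => Finset.sum_nonneg fun x _ => hpa _ _ _, ?_⟩
    simp only [Fintype.sum_prod_type, hT]
    rw [← hp1, Finset.sum_comm (s := (Finset.univ : Finset X))]
    refine Finset.sum_congr rfl fun y _ => ?_
    rw [Finset.sum_comm]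
    simp_rw [← Finset.mul_sum, (ha _).2, mul_one]
  have hPVpos : ∀ w, 0 < P w → 0 < PV w := fun w hw =>
    hw.trans_le (Finset.single_le_sum (f := fun v => p (w.1, w.2.1) * a w.1 v * b v w.2.1 w.2.2.1)
      (fun v _ => hpab _ _ _ _) (Finset.mem_univ w.2.2.2))
  have hTYpos : ∀ w, 0 < T w → 0 < TY w := fun w hw => by
    refine hw.trans_le (Finset.sum_le_sum fun x _ => ?_)
    refine mul_le_of_le_one_right (hp.1 _) ?_
    rw [← (ha x).2]
    exact Finset.single_le_sum (fun u _ => (ha x).1 u) (Finset.mem_univ _)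
  set δ := (R * Real.log 2 - (A - B)) / 4 with hδ
  have hδ0 : 0 < δ := by rw [hδ]; linarith
  set η := ε / 10 with hη
  have hη0 : 0 < η := by positivity
  obtain ⟨N₁, hN₁⟩ := eventually_sum_pi_upper hPpmf hPVpos (l := A + δ)
    (by rw [hAP]; linarith) (ε := ε / 20) (by positivity)
  obtain ⟨N₂, hN₂⟩ := eventually_sum_pi_lower hTpmf hTYpos (l := B - δ)
    (by rw [hBT]; linarith) hη0
  obtain ⟨N₃, hN₃⟩ : ∃ N : ℕ, ∀ n : ℕ, n ≥ N → Real.exp (-(n * δ)) ≤ min η (η * η) := by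
    have hmin : 0 < min η (η * η) := lt_min hη0 (mul_pos hη0 hη0)
    obtain ⟨N, hN⟩ := exists_pow_lt_of_lt_one hmin
      (show Real.exp (-δ) < 1 by rw [Real.exp_lt_one_iff]; linarith)
    refine ⟨N, fun n hn => ?_⟩
    rw [← mul_neg, Real.exp_nat_mul]
    exact (pow_le_pow_of_le_one (Real.exp_pos _).le
      (Real.exp_le_one_iff.2 (by linarith)) hn).trans hN.le
  refine ⟨max N₁ (max N₂ N₃), fun n hn => ?_⟩
  have hn₁ : n ≥ N₁ := (le_max_left _ _).trans hn
  have hn₂ : n ≥ N₂ := ((le_max_left _ _).trans (le_max_right _ _)).trans hn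
  have hn₃ : n ≥ N₃ := ((le_max_right _ _).trans (le_max_right _ _)).trans hn
  set e := Real.exp (-(n * δ)) with he
  have he1 : e ≤ η := (hN₃ n hn₃).trans (min_le_left _ _)
  have he2 : e ≤ η * η := (hN₃ n hn₃).trans (min_le_right _ _)
  set τ := Real.exp (n * (A + 2 * δ)) with hτ
  have hτ0 : 0 < τ := Real.exp_pos _
  set θ := min 1 τ with hθ
  have hθ0 : 0 < θ := lt_min one_pos hτ0
  have hθ1 : θ ≤ 1 := min_le_left _ _
  have hMpos : 0 < msgCard n R := msgCard_pos n R
  obtain ⟨enc, dec, henc, hdec, hle⟩ := exists_code_one_shot (U := Fin n → U) (X := Fin n → X)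
    (Y := Fin n → Y) (Z := Fin n → Z) hMpos hθ0 hθ1 (α := Real.exp (n * (A + δ)))
    (β := Real.exp (n * (B - δ))) (Real.exp_pos _).le (Real.exp_pos _) hη0
    (p := fun x y => ∏ i, p (x i, y i)) (fun x y => Finset.prod_nonneg fun i _ => hp.1 _)
    (by
      rw [sum_pi_prod (fun x y => ∏ i, p (x i, y i))]
      exact (IsPMF.pi fun _ : Fin n => hp).2)
    (a := fun x u => ∏ i, a (x i) (u i)) (fun x => IsPMF.pi fun i => ha (x i))
    (b := fun u y z => ∏ i, b (u i) (y i) (z i)) (fun u y => IsPMF.pi fun i => hb (u i) (y i))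
  refine ⟨enc, dec, henc, hdec, ?_⟩
  simp only [← Finset.prod_mul_distrib] at hle
  have c1 : ∀ (x : Fin n → X) (y : Fin n → Y) (z : Fin n → Z),
      ∑ u : Fin n → U, ∏ i, p (x i, y i) * a (x i) (u i) * b (u i) (y i) (z i)
        = ∏ i, ∑ u, p (x i, y i) * a (x i) u * b u (y i) (z i) := fun x y z =>
    sum_prod_pi (fun i u => p (x i, y i) * a (x i) u * b u (y i) (z i))
  have c2 : ∀ (y : Fin n → Y) (u : Fin n → U),
      ∑ x : Fin n → X, ∏ i, p (x i, y i) * a (x i) (u i)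
        = ∏ i, ∑ x, p (x, y i) * a x (u i) := fun y u =>
    sum_prod_pi (fun i x => p (x, y i) * a x (u i))
  have c3 : ∀ (y : Fin n → Y),
      ∑ x : Fin n → X, ∏ i, p (x i, y i) = ∏ i, ∑ x, p (x, y i) := fun y =>
    sum_prod_pi (fun i x => p (x, y i))
  simp only [c1, c2, c3] at hle
  rw [sum_pi_prod₄ (fun x y z u => if Real.exp (n * (A + δ)) *
      ∏ i, ∑ v, p (x i, y i) * a (x i) v * b v (y i) (z i)
        < ∏ i, p (x i, y i) * a (x i) (u i) * b (u i) (y i) (z i)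
      then ∏ i, p (x i, y i) * a (x i) (u i) * b (u i) (y i) (z i) else 0),
    sum_pi_prod (fun y u => if ∏ i, ∑ x, p (x, y i) * a x (u i)
        < Real.exp (n * (B - δ)) * ∏ i, ∑ x, p (x, y i)
      then ∏ i, ∑ x, p (x, y i) * a x (u i) else 0)] at hle
  refine hle.trans ?_
  have b1 := hN₁ n hn₁
  have b2 := hN₂ n hn₂
  simp only [hP, hPV] at b1
  simp only [hT, hTY] at b2
  have hα : Real.exp (n * (A + δ)) * ((1 - θ) / θ) ≤ e := by
    rcases le_total 1 τ with h | h
    · have : θ = 1 := min_eq_left h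
      rw [this]
      simp only [sub_self, zero_div, mul_zero]
      exact (Real.exp_pos _).le
    · have : θ = τ := min_eq_right h
      rw [this]
      calc _ ≤ Real.exp (n * (A + δ)) * (1 / τ) := by
            refine mul_le_mul_of_nonneg_left ?_ (Real.exp_pos _).le
            exact div_le_div_of_nonneg_right (by linarith) hτ0.le
        _ = e := by
            rw [hτ, one_div, ← Real.exp_neg, ← Real.exp_add, he]
            congr 1
            ring
  have hα2 : Real.exp (n * (A + δ)) * ((1 - θ) / θ) / η ≤ η := by
    rw [div_le_iff₀ hη0]
    exact hα.trans he2
  have hβ : θ / (msgCard n R * Real.exp (n * (B - δ))) ≤ e := by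
    rw [div_le_iff₀ (mul_pos (by exact_mod_cast hMpos) (Real.exp_pos _))]
    calc θ ≤ τ := min_le_right _ _
      _ = e * (Real.exp (n * (R * Real.log 2)) * Real.exp (n * (B - δ))) := by
          rw [hτ, he, ← Real.exp_add, ← Real.exp_add]
          congr 1
          have : R * Real.log 2 = 4 * δ + (A - B) := by rw [hδ]; ring
          rw [this]
          ring
      _ ≤ _ := by
          gcongr
          exact exp_le_msgCard n R
  have hηε : ε = 10 * η := by rw [hη]; ring
  have hη20 : ε / 20 = η / 2 := by rw [hη]; ring
  rw [hη20] at b1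
  linarith

theorem mass_eq_apply {Ω β : Type*} [Fintype Ω] (p : Ω → ℝ) {f : Ω → β} {b : β} {w₀ : Ω}
    (h : ∀ w, f w = b ↔ w = w₀) : mass p f b = p w₀ := by
  simp [mass, h]

/-- A joint law of `(U, X, Y, Z)` satisfying the Markov chains `U−X−Y` and `Z−(U,Y)−X` factors
into the law of `(X, Y)`, a channel from `X` to `U` and a channel from `(U, Y)` to `Z`. -/
theorem exists_factorization {U X Y Z : Type*} [Fintype U] [Fintype X] [Fintype Y] [Fintype Z]
    {J : U × X × Y × Z → ℝ} (hJ : ∀ w, 0 ≤ J w)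
    (h₁ : cmi J (fun w => w.1) (fun w => w.2.1) (fun w => w.2.2.1) = 0)
    (h₂ : cmi J (fun w => w.2.2.2) (fun w => (w.1, w.2.2.1)) (fun w => w.2.1) = 0)
    {a₀ : U → ℝ} (ha₀ : IsPMF a₀) {b₀ : Z → ℝ} (hb₀ : IsPMF b₀) :
    ∃ a : X → U → ℝ, ∃ b : U → Y → Z → ℝ, (∀ x, IsPMF (a x)) ∧ (∀ u y, IsPMF (b u y)) ∧
      ∀ u x y z, J (u, x, y, z)
        = mass J (fun w => (w.2.1, w.2.2.1)) (x, y) * a x u * b u y z := by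
  have m₁ := (cmi_nonneg_and_eq_zero hJ _ _ _).2 h₁
  have m₂ := (cmi_nonneg_and_eq_zero hJ _ _ _).2 h₂
  refine ⟨fun x u => if mass J (fun w => w.2.1) x = 0 then a₀ u else
      mass J (fun w => (w.1, w.2.1)) (u, x) / mass J (fun w => w.2.1) x,
    fun u y z => if mass J (fun w => (w.1, w.2.2.1)) (u, y) = 0 then b₀ z else
      mass J (fun w => (w.2.2.2, (w.1, w.2.2.1))) (z, (u, y))
        / mass J (fun w => (w.1, w.2.2.1)) (u, y), fun x => ?_, fun u y => ?_, fun u x y z => ?_⟩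
  · beta_reduce
    split_ifs with h
    · exact ha₀
    · refine ⟨fun u => div_nonneg (mass_nonneg hJ _ _) (mass_nonneg hJ _ _), ?_⟩
      rw [← Finset.sum_div, sum_mass_prod_left, div_self h]
  · beta_reduce
    split_ifs with h
    · exact hb₀
    · refine ⟨fun u => div_nonneg (mass_nonneg hJ _ _) (mass_nonneg hJ _ _), ?_⟩
      rw [← Finset.sum_div, sum_mass_prod_left, div_self h]
  · beta_reduce
    have e₁ := m₁ u x y
    have e₂ := m₂ z (u, y) x
    rw [mass_eq_apply J (w₀ := (u, x, y, z)) (by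
        rintro ⟨u', x', y', z'⟩
        simp only [Prod.mk.injEq]
        tauto),
      mass_congr J _ (fun w => (w.1, w.2.1, w.2.2.1)) ((u, y), x) (u, x, y) (by
        rintro ⟨u', x', y', z'⟩
        simp only [Prod.mk.injEq]
        tauto)] at e₂
    have l₁ : mass J (fun w => (w.2.1, w.2.2.1)) (x, y) ≤ mass J (fun w => w.2.1) x :=
      mass_le_mass hJ _ _ _ _ fun w h => (Prod.mk.inj h).1
    have l₂ : mass J (fun w => (w.1, w.2.1, w.2.2.1)) (u, x, y)
        ≤ mass J (fun w => (w.1, w.2.2.1)) (u, y) :=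
      mass_le_mass hJ _ _ _ _ fun w h => by
        simp only [Prod.mk.injEq] at h ⊢
        exact ⟨h.1, h.2.2⟩
    have l₃ : J (u, x, y, z) ≤ mass J (fun w => (w.1, w.2.1, w.2.2.1)) (u, x, y) := by
      rw [← mass_eq_apply J (f := id) (fun w => Iff.rfl)]
      refine mass_le_mass hJ _ _ _ _ fun w h => ?_
      simp only [id] at h
      rw [h]
    have l₄ : mass J (fun w => (w.1, w.2.1, w.2.2.1)) (u, x, y)
        ≤ mass J (fun w => (w.2.1, w.2.2.1)) (x, y) :=
      mass_le_mass hJ _ _ _ _ fun w h => (Prod.mk.inj h).2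
    have hJ0 := hJ (u, x, y, z)
    by_cases hX : mass J (fun w => w.2.1) x = 0
    · have hXY : mass J (fun w => (w.2.1, w.2.2.1)) (x, y) = 0 :=
        le_antisymm (l₁.trans hX.le) (mass_nonneg hJ _ _)
      rw [hXY, zero_mul, zero_mul]
      exact le_antisymm (l₃.trans (l₄.trans hXY.le)) hJ0
    · have e₃ : mass J (fun w => (w.2.1, w.2.2.1)) (x, y)
          * (mass J (fun w => (w.1, w.2.1)) (u, x) / mass J (fun w => w.2.1) x)
          = mass J (fun w => (w.1, w.2.1, w.2.2.1)) (u, x, y) := by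
        rw [← mul_div_assoc, mul_comm, ← e₁, mul_div_assoc, div_self hX, mul_one]
      rw [if_neg hX, e₃]
      by_cases hUY : mass J (fun w => (w.1, w.2.2.1)) (u, y) = 0
      · have h0 : mass J (fun w => (w.1, w.2.1, w.2.2.1)) (u, x, y) = 0 :=
          le_antisymm (l₂.trans hUY.le) (mass_nonneg hJ _ _)
        rw [h0, zero_mul]
        exact le_antisymm (l₃.trans h0.le) hJ0
      · rw [if_neg hUY, ← mul_div_assoc, mul_comm, ← e₂, mul_div_assoc, div_self hUY, mul_one]

/-- The conditional mutual information of a factorized law, as a difference of relative entropy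
sums. -/
theorem cmi_factorized_mul_log_two {U X Y Z : Type*} [Fintype U] [Fintype X] [Fintype Y]
    [Fintype Z] {p : X × Y → ℝ} (hp : IsPMF p)
    {a : X → U → ℝ} (ha : ∀ x, IsPMF (a x)) {b : U → Y → Z → ℝ} (hb : ∀ u y, IsPMF (b u y))
    {J : U × X × Y × Z → ℝ} (hJ : ∀ u x y z, J (u, x, y, z) = p (x, y) * a x u * b u y z) :
    cmi J (fun w => (w.2.1, w.2.2.2)) (fun w => w.2.2.1) (fun w => w.1) * Real.log 2
      = (∑ x, ∑ y, ∑ z, ∑ u, p (x, y) * a x u * b u y z * Real.log (p (x, y) * a x u * b u y z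
          / ∑ v, p (x, y) * a x v * b v y z))
        - (∑ y, ∑ u, (∑ x, p (x, y) * a x u) * Real.log ((∑ x, p (x, y) * a x u)
          / ∑ x, p (x, y))) := by
  have hJ0 : ∀ w, 0 ≤ J w := fun ⟨u, x, y, z⟩ => by
    rw [hJ]
    exact mul_nonneg (mul_nonneg (hp.1 _) ((ha x).1 u)) ((hb u y).1 z)
  have m₁ : ∀ x z y u, mass J (fun w => ((w.2.1, w.2.2.2), w.2.2.1, w.1)) ((x, z), y, u)
      = p (x, y) * a x u * b u y z := fun x z y u => by
    rw [mass_eq_apply J (w₀ := (u, x, y, z)) (by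
      rintro ⟨u', x', y', z'⟩
      simp only [Prod.mk.injEq]
      tauto), hJ]
  have m₂ : ∀ x z y, mass J (fun w => ((w.2.1, w.2.2.2), w.2.2.1)) ((x, z), y)
      = ∑ v, p (x, y) * a x v * b v y z := fun x z y => by
    rw [← sum_mass_prod_left J (fun w => w.1)]
    refine Finset.sum_congr rfl fun v _ => ?_
    rw [mass_eq_apply J (w₀ := (v, x, y, z)) (by
      rintro ⟨u', x', y', z'⟩
      simp only [Prod.mk.injEq]
      tauto), hJ]
  have m₃ : ∀ x y u, mass J (fun w => (w.2.1, w.2.2.1, w.1)) (x, y, u) = p (x, y) * a x u :=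
    fun x y u => by
    rw [← sum_mass_prod_left J (fun w => w.2.2.2)]
    rw [← mul_one (p (x, y) * a x u), ← (hb u y).2, Finset.mul_sum]
    refine Finset.sum_congr rfl fun z _ => ?_
    rw [mass_eq_apply J (w₀ := (u, x, y, z)) (by
      rintro ⟨u', x', y', z'⟩
      simp only [Prod.mk.injEq]
      tauto), hJ]
  have m₄ : ∀ y u, mass J (fun w => (w.2.2.1, w.1)) (y, u) = ∑ x, p (x, y) * a x u :=
    fun y u => by
    rw [← sum_mass_prod_left J (fun w => w.2.1)]
    exact Finset.sum_congr rfl fun x _ => m₃ x y u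
  have m₅ : ∀ y, mass J (fun w => w.2.2.1) y = ∑ x, p (x, y) := fun y => by
    rw [← sum_mass_prod_right J _ (fun w => w.1)]
    simp_rw [m₄]
    rw [Finset.sum_comm]
    simp_rw [← Finset.mul_sum, (ha _).2, mul_one]
  have hterm : ∀ w : U × X × Y × Z, J w *
      (Real.log (mass J (fun w => ((w.2.1, w.2.2.2), w.2.2.1, w.1))
          ((w.2.1, w.2.2.2), w.2.2.1, w.1)) + Real.log (mass J (fun w => w.2.2.1) w.2.2.1)
        - Real.log (mass J (fun w => ((w.2.1, w.2.2.2), w.2.2.1)) ((w.2.1, w.2.2.2), w.2.2.1))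
        - Real.log (mass J (fun w => (w.2.2.1, w.1)) (w.2.2.1, w.1)))
      = J w * Real.log (J w / mass J (fun w => ((w.2.1, w.2.2.2), w.2.2.1))
          ((w.2.1, w.2.2.2), w.2.2.1))
        - J w * Real.log (mass J (fun w => (w.2.2.1, w.1)) (w.2.2.1, w.1)
          / mass J (fun w => w.2.2.1) w.2.2.1) := fun ⟨u, x, y, z⟩ => by
    rcases (hJ0 (u, x, y, z)).eq_or_lt with h | h
    · rw [← h]; ring
    · have hq : mass J (fun w => ((w.2.1, w.2.2.2), w.2.2.1, w.1)) ((x, z), y, u)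
          = J (u, x, y, z) := by rw [m₁, hJ]
      have h₁ : 0 < mass J (fun w => ((w.2.1, w.2.2.2), w.2.2.1)) ((x, z), y) := by
        refine h.trans_le (hq.symm.le.trans (mass_le_mass hJ0 _ _ _ _ fun w e => ?_))
        simp only [Prod.mk.injEq] at e ⊢
        tauto
      have h₂ : 0 < mass J (fun w => (w.2.2.1, w.1)) (y, u) :=
        h.trans_le (hq.symm.le.trans (mass_le_mass hJ0 _ _ _ _ fun w e => (Prod.mk.inj e).2))
      have h₃ : 0 < mass J (fun w => w.2.2.1) y :=
        h₂.trans_le (mass_le_mass hJ0 _ _ _ _ fun w e => (Prod.mk.inj e).1)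
      simp only [hq]
      rw [Real.log_div h.ne' h₁.ne', Real.log_div h₂.ne' h₃.ne']
      ring
  rw [cmi_mul_log_two, Finset.sum_congr rfl fun w _ => hterm w, Finset.sum_sub_distrib,
    ← sum_mass_mul J (fun w => (w.2.2.1, w.1)) (fun t => Real.log
      (mass J (fun w => (w.2.2.1, w.1)) t / mass J (fun w => w.2.2.1) t.1))]
  simp only [Fintype.sum_prod_type, m₂, m₄, m₅, hJ]
  congr 1
  rw [Finset.sum_comm]
  refine Finset.sum_congr rfl fun x _ => ?_
  rw [Finset.sum_comm]
  exact Finset.sum_congr rfl fun y _ => Finset.sum_comm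

/-- A nonnegative function comes within any positive slack of its infimum. -/
theorem exists_forall_le_add {α : Type*} [Nonempty α] (f : α → ℝ) (hf : ∀ c, 0 ≤ f c) {δ : ℝ}
    (hδ : 0 < δ) : ∃ c, ∀ d, f c ≤ f d + δ := by
  obtain ⟨c, hc⟩ := exists_lt_of_ciInf_lt (lt_add_of_pos_right (⨅ d, f d) hδ)
  have hbdd : BddBelow (Set.range f) := ⟨0, by rintro _ ⟨d, rfl⟩; exact hf d⟩
  exact ⟨c, fun d => hc.le.trans (add_le_add (ciInf_le hbdd d) le_rfl)⟩

theorem tv_nonneg {α : Type*} [Fintype α] (p q : α → ℝ) : 0 ≤ tv p q :=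
  mul_nonneg (by norm_num) (Finset.sum_nonneg fun _ _ => abs_nonneg _)

/-- Codes that are eventually good for each fixed accuracy can be merged into one sequence. -/
theorem achievableNP_of_forall_eventually {X Y Z : Type*} [Fintype X] [Fintype Y] [Fintype Z]
    {pXY : X × Y → ℝ} {Q : X → Y → Z → ℝ} {R : ℝ} (hR : 0 ≤ R) {q : Z → ℝ} (hq : IsPMF q)
    (h : ∀ ε : ℝ, 0 < ε → ∃ N : ℕ, ∀ n ≥ N, ∃ enc : (Fin n → X) → Fin (msgCard n R) → ℝ,
      ∃ dec : Fin (msgCard n R) → (Fin n → Y) → (Fin n → Z) → ℝ,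
      (∀ x, IsPMF (enc x)) ∧ (∀ m y, IsPMF (dec m y)) ∧
      tv (fun w : (Fin n → X) × (Fin n → Y) × (Fin n → Z) =>
            ∑ m, inducedPMF pXY n R enc dec (w.1, w.2.1, m, w.2.2))
         (prodXYZ pXY Q n) ≤ ε) :
    AchievableNP pXY Q R := by
  have key : ∀ n : ℕ, ∃ enc : (Fin n → X) → Fin (msgCard n R) → ℝ,
      ∃ dec : Fin (msgCard n R) → (Fin n → Y) → (Fin n → Z) → ℝ,
      (∀ x, IsPMF (enc x)) ∧ (∀ m y, IsPMF (dec m y)) ∧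
      ∀ (enc' : (Fin n → X) → Fin (msgCard n R) → ℝ)
        (dec' : Fin (msgCard n R) → (Fin n → Y) → (Fin n → Z) → ℝ),
        (∀ x, IsPMF (enc' x)) → (∀ m y, IsPMF (dec' m y)) →
        tv (fun w : (Fin n → X) × (Fin n → Y) × (Fin n → Z) =>
            ∑ m, inducedPMF pXY n R enc dec (w.1, w.2.1, m, w.2.2)) (prodXYZ pXY Q n)
          ≤ tv (fun w : (Fin n → X) × (Fin n → Y) × (Fin n → Z) =>
            ∑ m, inducedPMF pXY n R enc' dec' (w.1, w.2.1, m, w.2.2)) (prodXYZ pXY Q n)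
            + 1 / ((n : ℝ) + 1) := by
    intro n
    let C := {c : ((Fin n → X) → Fin (msgCard n R) → ℝ) ×
      (Fin (msgCard n R) → (Fin n → Y) → (Fin n → Z) → ℝ) //
      (∀ x, IsPMF (c.1 x)) ∧ (∀ m y, IsPMF (c.2 m y))}
    have : Nonempty C := ⟨⟨(fun _ m => if m = ⟨0, msgCard_pos n R⟩ then 1 else 0,
      fun _ _ z => ∏ i, q (z i)),
      fun x => ⟨fun m => by dsimp only; split_ifs <;> norm_num, by simp⟩,
      fun m y => IsPMF.pi fun _ : Fin n => hq⟩⟩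
    obtain ⟨c, hc⟩ := exists_forall_le_add
      (fun c : C => tv (fun w : (Fin n → X) × (Fin n → Y) × (Fin n → Z) =>
        ∑ m, inducedPMF pXY n R c.1.1 c.1.2 (w.1, w.2.1, m, w.2.2)) (prodXYZ pXY Q n))
      (fun c => tv_nonneg _ _) (Nat.one_div_pos_of_nat (α := ℝ) (n := n))
    exact ⟨c.1.1, c.1.2, c.2.1, c.2.2, fun enc' dec' h₁ h₂ => hc ⟨(enc', dec'), h₁, h₂⟩⟩
  choose enc dec henc hdec hle using key
  refine ⟨hR, enc, dec, henc, hdec, fun ε hε => ?_⟩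
  obtain ⟨N, hN⟩ := h (ε / 2) (half_pos hε)
  obtain ⟨K, hK⟩ := exists_nat_one_div_lt (half_pos hε)
  refine ⟨max N K + 1, Nat.succ_pos _, ?_⟩
  obtain ⟨enc', dec', h₁, h₂, h₃⟩ := hN (max N K + 1) ((le_max_left _ _).trans (Nat.le_succ _))
  refine (hle _ enc' dec' h₁ h₂).trans ?_
  have : 1 / (((max N K + 1 : ℕ) : ℝ) + 1) ≤ 1 / ((K : ℝ) + 1) :=
    Nat.one_div_le_one_div ((le_max_right _ _).trans (Nat.le_succ _))
  linarith

variable {𝒳 𝒴 𝒵 : Type*} [Fintype 𝒳] [Fintype 𝒴] [Fintype 𝒵]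
variable [Nonempty 𝒳] [Nonempty 𝒴] [Nonempty 𝒵]

/-- If the joint pmf `p_XYZ · p_{U|XYZ}` satisfies the Markov chains
`U−X−Y` and `Z−(U,Y)−X`, then every rate `R > I(X,Z;U|Y)` is achievable without
privacy for `(p_XY, p_{Z|XY})`. -/
theorem np_achievability
    (pXY : 𝒳 × 𝒴 → ℝ) (Q : 𝒳 → 𝒴 → 𝒵 → ℝ)
    (hpXY : IsPMF pXY) (hQ : ∀ x y, IsPMF (Q x y))
    (k : ℕ) (pU : 𝒳 × 𝒴 × 𝒵 → Fin k → ℝ) (hU : NPAux pXY Q pU)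
    (R : ℝ)
    (hR : cmi (jointU pXY Q pU) (fun w => (w.2.1, w.2.2.2)) (fun w => w.2.2.1)
            (fun w => w.1) < R) :
    AchievableNP pXY Q R := by
  obtain ⟨hpU, hM₁, hM₂⟩ := hU
  have hJ0 : ∀ w, 0 ≤ jointU pXY Q pU w := fun w =>
    mul_nonneg (mul_nonneg (hpXY.1 _) ((hQ _ _).1 _)) ((hpU _).1 _)
  obtain ⟨x₀⟩ := ‹Nonempty 𝒳›
  obtain ⟨y₀⟩ := ‹Nonempty 𝒴›
  obtain ⟨z₀⟩ := ‹Nonempty 𝒵›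
  obtain ⟨a, b, ha, hb, hJ⟩ := exists_factorization hJ0 hM₁ hM₂ (hpU (x₀, y₀, z₀)) (hQ x₀ y₀)
  have hmXY : ∀ x y, mass (jointU pXY Q pU) (fun w => (w.2.1, w.2.2.1)) (x, y) = pXY (x, y) := by
    intro x y
    rw [← sum_mass_prod_left _ (fun w => w.2.2.2)]
    rw [← mul_one (pXY (x, y)), ← (hQ x y).2, Finset.mul_sum]
    refine Finset.sum_congr rfl fun z _ => ?_
    rw [← sum_mass_prod_left _ (fun w => w.1)]
    rw [← mul_one (pXY (x, y) * Q x y z), ← (hpU (x, y, z)).2, Finset.mul_sum]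
    refine Finset.sum_congr rfl fun u _ => ?_
    rw [mass_eq_apply _ (w₀ := (u, x, y, z)) (by
      rintro ⟨u', x', y', z'⟩
      simp only [Prod.mk.injEq]
      tauto)]
    rfl
  simp only [hmXY] at hJ
  have hlog2 : 0 < Real.log 2 := Real.log_pos one_lt_two
  have hR' := mul_lt_mul_of_pos_right hR hlog2
  rw [cmi_factorized_mul_log_two hpXY ha hb hJ] at hR'
  have : Nonempty (Fin k) := by
    by_contra hk
    rw [not_nonempty_iff] at hk
    simpa using (hpU (x₀, y₀, z₀)).2
  refine achievableNP_of_forall_eventually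
    ((cmi_nonneg_and_eq_zero hJ0 _ _ _).1.trans hR.le) (hQ x₀ y₀) fun ε hε => ?_
  obtain ⟨N, hN⟩ := eventually_exists_code hpXY ha hb hR' hε
  refine ⟨N, fun n hn => ?_⟩
  obtain ⟨enc, dec, henc, hdec, hle⟩ := hN n hn
  refine ⟨enc, dec, henc, hdec, ?_⟩
  have hXYZ : ∀ x y z, jointXYZ pXY Q (x, y, z) = ∑ u, pXY (x, y) * a x u * b u y z := by
    intro x y z
    simp only [← hJ, jointU]
    rw [← Finset.mul_sum, (hpU (x, y, z)).2, mul_one]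
  have hind : ∀ x y z, ∑ m, inducedPMF pXY n R enc dec (x, y, m, z)
      = (∏ i, pXY (x i, y i)) * ∑ m, enc x m * dec m y z := by
    intro x y z
    simp only [inducedPMF, Finset.mul_sum, mul_assoc]
  simp only [tv, Fintype.sum_prod_type, hind, prodXYZ, hXYZ]
  linarith

end SC
end

section
/- Suppose p_{Z|XY}(z|x,y) = 1{z = f(x,y)} for some function f: X×Y → Z. Then for every finite set U and every conditional pmf p_{U|XYZ} whose joint pmf p_XYZ·p_{U|XYZ} satisfies the Markov chain U−X−Y: (a) the Markov chain Z−(U,Y)−X holds if and only if H(Z|U,Y) = 0; and (b) whenever it holds, I(X,Z;U|Y) = I(X;U|Y). Consequently, the minimum of I(X,Z;U|Y) over p_{U|XYZ} with U−X−Y and Z−(U,Y)−X equals the minimum of I(X;U|Y) over p_{U|XYZ} with U−X−Y and H(Z|U,Y) = 0. -/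
open scoped BigOperators
open scoped Classical

namespace SC

/-- Entropy as an expectation of the log-probability of the fibre through each outcome. -/
theorem Hof_eq_neg_sum {Ω β : Type*} [Fintype Ω] (p : Ω → ℝ) (f : Ω → β) :
    Hof p f = (∑ ω, -(p ω *
      Real.log (∑ a ∈ Finset.univ.filter (fun a => f a = f ω), p a))) / Real.log 2 := by
  unfold Hof
  congr 1
  rw [← Finset.sum_fiberwise_of_maps_to (s := Finset.univ) (t := Finset.univ.image f) (g := f)
    (fun ω _ => Finset.mem_image_of_mem f (Finset.mem_univ ω))]
  refine Finset.sum_congr rfl fun b _ => ?_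
  rw [Real.negMulLog, neg_mul, Finset.sum_mul, ← Finset.sum_neg_distrib]
  refine Finset.sum_congr rfl fun ω hω => ?_
  rw [(Finset.mem_filter.mp hω).2]

/-- Functions with the same fibres on the support of `p` have the same entropy. -/
theorem Hof_congr_of_fibers {Ω β γ : Type*} [Fintype Ω] (p : Ω → ℝ) (f : Ω → β) (g : Ω → γ)
    (h : ∀ a b, p a ≠ 0 → p b ≠ 0 → (f a = f b ↔ g a = g b)) : Hof p f = Hof p g := by
  rw [Hof_eq_neg_sum, Hof_eq_neg_sum]
  congr 1
  refine Finset.sum_congr rfl fun ω _ => ?_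
  by_cases hω : p ω = 0
  · simp [hω]
  congr 3
  rw [Finset.sum_filter, Finset.sum_filter]
  refine Finset.sum_congr rfl fun a _ => ?_
  by_cases ha : p a = 0
  · simp [ha]
  simp only [h a ω ha hω]

/-- If `Z = f (X, Y)`, then `Z` takes the value `f (x, y)` on the support of the joint pmf. -/
theorem eq_of_jointU_ne_zero {𝒳 𝒴 𝒵 : Type*} [Fintype 𝒳] [Fintype 𝒴] [Fintype 𝒵]
    {pXY : 𝒳 × 𝒴 → ℝ} {Q : 𝒳 → 𝒴 → 𝒵 → ℝ} {f : 𝒳 × 𝒴 → 𝒵}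
    (hdet : ∀ x y z, Q x y z = if z = f (x, y) then 1 else 0) {k : ℕ}
    {pU : 𝒳 × 𝒴 × 𝒵 → Fin k → ℝ} {w : Fin k × 𝒳 × 𝒴 × 𝒵} (hw : jointU pXY Q pU w ≠ 0) :
    w.2.2.2 = f (w.2.1, w.2.2.1) := by
  by_contra hne
  exact hw (by simp [jointU, jointXYZ, hdet, hne])

/-- If `Z = f (X, Y)`, then `I(Z; X | U, Y) = H(Z | U, Y)`. -/
theorem cmi_eq_condEnt_of_deterministic {𝒳 𝒴 𝒵 : Type*} [Fintype 𝒳] [Fintype 𝒴] [Fintype 𝒵]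
    (pXY : 𝒳 × 𝒴 → ℝ) (Q : 𝒳 → 𝒴 → 𝒵 → ℝ) (f : 𝒳 × 𝒴 → 𝒵)
    (hdet : ∀ x y z, Q x y z = if z = f (x, y) then 1 else 0) {k : ℕ}
    (pU : 𝒳 × 𝒴 × 𝒵 → Fin k → ℝ) :
    cmi (jointU pXY Q pU) (fun w => w.2.2.2) (fun w => (w.1, w.2.2.1)) (fun w => w.2.1)
      = condEnt (jointU pXY Q pU) (fun w => w.2.2.2) (fun w => (w.1, w.2.2.1)) := by
  have h : Hof (jointU pXY Q pU) (fun w => (w.2.2.2, (w.1, w.2.2.1), w.2.1))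
      = Hof (jointU pXY Q pU) (fun w => ((w.1, w.2.2.1), w.2.1)) := by
    refine Hof_congr_of_fibers _ _ _ fun a b ha hb => ?_
    have ha' := eq_of_jointU_ne_zero hdet ha
    have hb' := eq_of_jointU_ne_zero hdet hb
    simp only [Prod.mk.injEq, ha', hb']
    grind
  simp only [cmi, condEnt, h]
  ring

/-- If `Z = f (X, Y)`, then `I(X, Z; U | Y) = I(X; U | Y)`. -/
theorem cmi_pair_eq_of_deterministic {𝒳 𝒴 𝒵 : Type*} [Fintype 𝒳] [Fintype 𝒴] [Fintype 𝒵]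
    (pXY : 𝒳 × 𝒴 → ℝ) (Q : 𝒳 → 𝒴 → 𝒵 → ℝ) (f : 𝒳 × 𝒴 → 𝒵)
    (hdet : ∀ x y z, Q x y z = if z = f (x, y) then 1 else 0) {k : ℕ}
    (pU : 𝒳 × 𝒴 × 𝒵 → Fin k → ℝ) :
    cmi (jointU pXY Q pU) (fun w => (w.2.1, w.2.2.2)) (fun w => w.2.2.1) (fun w => w.1)
      = cmi (jointU pXY Q pU) (fun w => w.2.1) (fun w => w.2.2.1) (fun w => w.1) := by
  have h₁ : Hof (jointU pXY Q pU) (fun w => ((w.2.1, w.2.2.2), w.2.2.1))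
      = Hof (jointU pXY Q pU) (fun w => (w.2.1, w.2.2.1)) := by
    refine Hof_congr_of_fibers _ _ _ fun a b ha hb => ?_
    have ha' := eq_of_jointU_ne_zero hdet ha
    have hb' := eq_of_jointU_ne_zero hdet hb
    simp only [Prod.mk.injEq, ha', hb']
    grind
  have h₂ : Hof (jointU pXY Q pU) (fun w => ((w.2.1, w.2.2.2), w.2.2.1, w.1))
      = Hof (jointU pXY Q pU) (fun w => (w.2.1, w.2.2.1, w.1)) := by
    refine Hof_congr_of_fibers _ _ _ fun a b ha hb => ?_
    have ha' := eq_of_jointU_ne_zero hdet ha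
    have hb' := eq_of_jointU_ne_zero hdet hb
    simp only [Prod.mk.injEq, ha', hb']
    grind
  simp only [cmi, h₁, h₂]

variable {𝒳 𝒴 𝒵 : Type*} [Fintype 𝒳] [Fintype 𝒴] [Fintype 𝒵]
variable [Nonempty 𝒳] [Nonempty 𝒴] [Nonempty 𝒵]

/-- Suppose `p_{Z|XY}(z|x,y) = 1{z = f(x,y)}`. Then for every finite
`U` and conditional pmf `p_{U|XYZ}` whose joint pmf satisfies `U−X−Y`:
(a) `Z−(U,Y)−X` holds iff `H(Z|U,Y) = 0`; (b) whenever it holds,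
`I(X,Z;U|Y) = I(X;U|Y)`. Consequently the two constrained minima coincide. -/
theorem deterministic_function_reduction
    (pXY : 𝒳 × 𝒴 → ℝ) (Q : 𝒳 → 𝒴 → 𝒵 → ℝ)
    (hpXY : IsPMF pXY) (hQ : ∀ x y, IsPMF (Q x y))
    (f : 𝒳 × 𝒴 → 𝒵) (hdet : ∀ x y z, Q x y z = if z = f (x, y) then 1 else 0) :
    (∀ (k : ℕ) (pU : 𝒳 × 𝒴 × 𝒵 → Fin k → ℝ), (∀ w, IsPMF (pU w)) →
      cmi (jointU pXY Q pU) (fun w => w.1) (fun w => w.2.1) (fun w => w.2.2.1) = 0 →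
      ((cmi (jointU pXY Q pU) (fun w => w.2.2.2) (fun w => (w.1, w.2.2.1))
          (fun w => w.2.1) = 0)
        ↔ condEnt (jointU pXY Q pU) (fun w => w.2.2.2) (fun w => (w.1, w.2.2.1)) = 0)) ∧
    (∀ (k : ℕ) (pU : 𝒳 × 𝒴 × 𝒵 → Fin k → ℝ), (∀ w, IsPMF (pU w)) →
      cmi (jointU pXY Q pU) (fun w => w.1) (fun w => w.2.1) (fun w => w.2.2.1) = 0 →
      cmi (jointU pXY Q pU) (fun w => w.2.2.2) (fun w => (w.1, w.2.2.1))
          (fun w => w.2.1) = 0 →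
      cmi (jointU pXY Q pU) (fun w => (w.2.1, w.2.2.2)) (fun w => w.2.2.1)
          (fun w => w.1)
        = cmi (jointU pXY Q pU) (fun w => w.2.1) (fun w => w.2.2.1) (fun w => w.1)) ∧
    sInf {r : ℝ | ∃ (k : ℕ) (pU : 𝒳 × 𝒴 × 𝒵 → Fin k → ℝ), (∀ w, IsPMF (pU w)) ∧
        cmi (jointU pXY Q pU) (fun w => w.1) (fun w => w.2.1) (fun w => w.2.2.1) = 0 ∧
        cmi (jointU pXY Q pU) (fun w => w.2.2.2) (fun w => (w.1, w.2.2.1))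
          (fun w => w.2.1) = 0 ∧
        r = cmi (jointU pXY Q pU) (fun w => (w.2.1, w.2.2.2)) (fun w => w.2.2.1)
              (fun w => w.1)}
      = sInf {r : ℝ | ∃ (k : ℕ) (pU : 𝒳 × 𝒴 × 𝒵 → Fin k → ℝ), (∀ w, IsPMF (pU w)) ∧
          cmi (jointU pXY Q pU) (fun w => w.1) (fun w => w.2.1) (fun w => w.2.2.1) = 0 ∧
          condEnt (jointU pXY Q pU) (fun w => w.2.2.2) (fun w => (w.1, w.2.2.1)) = 0 ∧
          r = cmi (jointU pXY Q pU) (fun w => w.2.1) (fun w => w.2.2.1) (fun w => w.1)} := by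
  refine ⟨fun k pU _ _ => ?_, fun k pU _ _ _ => ?_, ?_⟩
  · rw [cmi_eq_condEnt_of_deterministic pXY Q f hdet]
  · exact cmi_pair_eq_of_deterministic pXY Q f hdet pU
  · simp only [cmi_eq_condEnt_of_deterministic pXY Q f hdet,
      cmi_pair_eq_of_deterministic pXY Q f hdet]

end SC
end

section
/- For all y, y' ∈ Y, all i ∈ [k(y)] and all j ∈ [k(y')]: if α_i^(y) ≠ α_j^(y'), then U_i^(y) ∩ U_j^(y') = ∅. -/
open scoped BigOperators
open scoped Classical

namespace SC

/-- `p_{U|XYZ}` is a conditional pmf whose joint pmf `p_XYZ · p_{U|XYZ}` satisfies the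
three Markov chains `U−X−Y`, `Z−(U,Y)−X` and `U−(Y,Z)−X`. -/
def SecureAux {𝒳 𝒴 𝒵 : Type*} [Fintype 𝒳] [Fintype 𝒴] [Fintype 𝒵]
    (pXY : 𝒳 × 𝒴 → ℝ) (Q : 𝒳 → 𝒴 → 𝒵 → ℝ) {k : ℕ}
    (pU : 𝒳 × 𝒴 × 𝒵 → Fin k → ℝ) : Prop :=
  (∀ w, IsPMF (pU w)) ∧
  cmi (jointU pXY Q pU) (fun w => w.1) (fun w => w.2.1) (fun w => w.2.2.1) = 0 ∧
  cmi (jointU pXY Q pU) (fun w => w.2.2.2) (fun w => (w.1, w.2.2.1)) (fun w => w.2.1) = 0 ∧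
  cmi (jointU pXY Q pU) (fun w => w.1) (fun w => (w.2.2.1, w.2.2.2)) (fun w => w.2.1) = 0

/-- `(p_XY, p_{Z|XY})` is computable with perfect security. -/
def PerfectlySecure {𝒳 𝒴 𝒵 : Type*} [Fintype 𝒳] [Fintype 𝒴] [Fintype 𝒵]
    (pXY : 𝒳 × 𝒴 → ℝ) (Q : 𝒳 → 𝒴 → 𝒵 → ℝ) : Prop :=
  ∃ (k : ℕ) (pU : 𝒳 × 𝒴 × 𝒵 → Fin k → ℝ), SecureAux pXY Q pU

/-- `Z^(y)`: outputs occurring with positive probability when Bob's input is `y`. -/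
def Zyset {𝒳 𝒴 𝒵 : Type*} (Q : 𝒳 → 𝒴 → 𝒵 → ℝ) (y : 𝒴) : Set 𝒵 :=
  {z | ∃ x, 0 < Q x y z}

/-- `z ∼_y z'`: the columns of `z` and `z'` are positive scalar multiples of each
other (both in `Z^(y)`). -/
def SimRel {𝒳 𝒴 𝒵 : Type*} (Q : 𝒳 → 𝒴 → 𝒵 → ℝ) (y : 𝒴) (z z' : 𝒵) : Prop :=
  z ∈ Zyset Q y ∧ z' ∈ Zyset Q y ∧ ∃ c : ℝ, 0 < c ∧ ∀ x, Q x y z = c * Q x y z'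

/-- The `≡_y`-equivalence class of `z₀`, where `≡_y` is the equivalence relation
generated by `∼_y`. -/
def classOf {𝒳 𝒴 𝒵 : Type*} (Q : 𝒳 → 𝒴 → 𝒵 → ℝ) (y : 𝒴) (z₀ : 𝒵) : Set 𝒵 :=
  {z | Relation.EqvGen (SimRel Q y) z z₀}

/-- The probability column vector `α` of (the class of) `z`: the normalized column. -/
noncomputable def alphaVec {𝒳 𝒴 𝒵 : Type*} [Fintype 𝒳]
    (Q : 𝒳 → 𝒴 → 𝒵 → ℝ) (y : 𝒴) (z : 𝒵) : 𝒳 → ℝ :=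
  fun x => Q x y z / ∑ x', Q x' y z

/-- The set `{α_1^(y), …, α_{k(y)}^(y)}` of probability vectors of the classes at `y`. -/
def alphaSet {𝒳 𝒴 𝒵 : Type*} [Fintype 𝒳] (Q : 𝒳 → 𝒴 → 𝒵 → ℝ) (y : 𝒴) :
    Set (𝒳 → ℝ) :=
  alphaVec Q y '' Zyset Q y

/-- `Σ_{z ∈ Z_i^(y)} p_{Z|XY}(z|x,y)` where `Z_i^(y)` is the class of `z₀`. -/
noncomputable def classSumOf {𝒳 𝒴 𝒵 : Type*} [Fintype 𝒵]
    (Q : 𝒳 → 𝒴 → 𝒵 → ℝ) (x : 𝒳) (y : 𝒴) (z₀ : 𝒵) : ℝ :=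
  ∑ z ∈ Finset.univ.filter (fun z => z ∈ classOf Q y z₀), Q x y z

/-- `Σ_{z ∈ Z_i^(y)} p_{Z|XY}(z|x,y)` where `Z_i^(y)` is the class with vector `α`. -/
noncomputable def classSumA {𝒳 𝒴 𝒵 : Type*} [Fintype 𝒳] [Fintype 𝒵]
    (Q : 𝒳 → 𝒴 → 𝒵 → ℝ) (x : 𝒳) (y : 𝒴) (α : 𝒳 → ℝ) : ℝ :=
  ∑ z ∈ Finset.univ.filter (fun z => z ∈ Zyset Q y ∧ alphaVec Q y z = α), Q x y z

/-- The mass that the pushforward of `p` along `f` gives to `b`. -/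
noncomputable def marginal {Ω β : Type*} [Fintype Ω] (p : Ω → ℝ) (f : Ω → β) (b : β) : ℝ :=
  ∑ a ∈ Finset.univ.filter (fun a => f a = b), p a

theorem marginal_nonneg {Ω β : Type*} [Fintype Ω] {p : Ω → ℝ} (hp : ∀ ω, 0 ≤ p ω)
    (f : Ω → β) (b : β) : 0 ≤ marginal p f b :=
  Finset.sum_nonneg fun ω _ => hp ω

theorem Hof_eq_sum_marginal {Ω β : Type*} [Fintype Ω] [Fintype β] (p : Ω → ℝ) (f : Ω → β) :
    Hof p f = (∑ b, Real.negMulLog (marginal p f b)) / Real.log 2 := by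
  unfold Hof
  congr 1
  refine Finset.sum_subset (Finset.subset_univ _) fun b _ hb => ?_
  rw [Finset.filter_eq_empty_iff.2, Finset.sum_empty, Real.negMulLog_zero]
  intro a _ h
  exact hb (Finset.mem_image.2 ⟨a, Finset.mem_univ _, h⟩)

theorem sum_marginal_prod {Ω β γ : Type*} [Fintype Ω] [Fintype γ] (p : Ω → ℝ)
    (f : Ω → β) (g : Ω → γ) (b : β) :
    ∑ c, marginal p (fun ω => (f ω, g ω)) (b, c) = marginal p f b := by
  simp only [marginal, Finset.sum_filter, Prod.mk.injEq, ite_and]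
  rw [Finset.sum_comm]
  refine Finset.sum_congr rfl fun ω _ => ?_
  split_ifs <;> simp

theorem sum_marginal_prod' {Ω β γ : Type*} [Fintype Ω] [Fintype β] (p : Ω → ℝ)
    (f : Ω → β) (g : Ω → γ) (c : γ) :
    ∑ b, marginal p (fun ω => (f ω, g ω)) (b, c) = marginal p g c := by
  simp only [marginal, Finset.sum_filter, Prod.mk.injEq, ite_and]
  rw [Finset.sum_comm]
  simp

/-- The Kullback–Leibler summand is nonnegative and vanishes only at equal arguments. -/
theorem mul_log_div_add_sub_nonneg {m r : ℝ} (hm : 0 ≤ m) (hr : 0 ≤ r) (h : r = 0 → m = 0) :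
    0 ≤ m * Real.log (m / r) + r - m ∧ (m * Real.log (m / r) + r - m = 0 → m = r) := by
  rcases hr.eq_or_lt with h0 | h0
  · simp [h h0.symm, ← h0]
  · have e : m * Real.log (m / r) + r - m = r * InformationTheory.klFun (m / r) := by
      unfold InformationTheory.klFun
      field_simp
    have hq : 0 ≤ m / r := by positivity
    rw [e]
    refine ⟨mul_nonneg hr (InformationTheory.klFun_nonneg hq), fun h => ?_⟩
    have := (InformationTheory.klFun_eq_zero_iff hq).1
      ((mul_eq_zero.1 h).resolve_left h0.ne')
    field_simp at this
    exact this

/-- Vanishing conditional mutual information forces the joint masses to factorize. -/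
theorem mul_eq_mul_of_entropies {α β γ : Type*} [Fintype α] [Fintype β] [Fintype γ]
    (M : α → β → γ → ℝ) (AB : α → β → ℝ) (BC : β → γ → ℝ) (B : β → ℝ)
    (hM : ∀ a b c, 0 ≤ M a b c)
    (hAB : ∀ a b, ∑ c, M a b c = AB a b) (hBC : ∀ b c, ∑ a, M a b c = BC b c)
    (hBA : ∀ b, ∑ a, AB a b = B b) (hBC' : ∀ b, ∑ c, BC b c = B b)
    (h : (∑ a, ∑ b, Real.negMulLog (AB a b)) + (∑ b, ∑ c, Real.negMulLog (BC b c))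
      - (∑ b, Real.negMulLog (B b)) - ∑ a, ∑ b, ∑ c, Real.negMulLog (M a b c) = 0)
    (a : α) (b : β) (c : γ) : M a b c * B b = AB a b * BC b c := by
  have hAB0 : ∀ a b, 0 ≤ AB a b := fun a b => hAB a b ▸ Finset.sum_nonneg fun c _ => hM a b c
  have hBC0 : ∀ b c, 0 ≤ BC b c := fun b c => hBC b c ▸ Finset.sum_nonneg fun a _ => hM a b c
  have hB0 : ∀ b, 0 ≤ B b := fun b => hBA b ▸ Finset.sum_nonneg fun a _ => hAB0 a b
  have leAB : ∀ a b c, M a b c ≤ AB a b := fun a b c => hAB a b ▸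
    Finset.single_le_sum (f := fun c => M a b c) (fun c _ => hM a b c) (Finset.mem_univ c)
  have leBC : ∀ a b c, M a b c ≤ BC b c := fun a b c => hBC b c ▸
    Finset.single_le_sum (f := fun a => M a b c) (fun a _ => hM a b c) (Finset.mem_univ a)
  have leB : ∀ a b, AB a b ≤ B b := fun a b => hBA b ▸
    Finset.single_le_sum (f := fun a => AB a b) (fun a _ => hAB0 a b) (Finset.mem_univ a)
  set r : α → β → γ → ℝ := fun a b c => AB a b * BC b c / B b with hr
  have hr0 : ∀ a b c, 0 ≤ r a b c := fun a b c =>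
    div_nonneg (mul_nonneg (hAB0 a b) (hBC0 b c)) (hB0 b)
  have hrM : ∀ a b c, r a b c = 0 → M a b c = 0 := by
    intro a b c h
    refine le_antisymm ?_ (hM a b c)
    rcases div_eq_zero_iff.1 h with h | h
    · rcases mul_eq_zero.1 h with h | h
      · exact h ▸ leAB a b c
      · exact h ▸ leBC a b c
    · exact h ▸ (leAB a b c).trans (leB a b)
  have key : ∀ a b c, M a b c * Real.log (M a b c / r a b c) =
      M a b c * Real.log (M a b c) + M a b c * Real.log (B b)
        - M a b c * Real.log (AB a b) - M a b c * Real.log (BC b c) := by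
    intro a b c
    rcases (hM a b c).eq_or_lt with h0 | h0
    · simp [← h0]
    · have h1 := h0.trans_le (leAB a b c)
      have h2 := h0.trans_le (leBC a b c)
      have h3 := h1.trans_le (leB a b)
      rw [hr, Real.log_div h0.ne' (by positivity), Real.log_div (by positivity) h3.ne',
        Real.log_mul h1.ne' h2.ne']
      ring
  have sum_r : ∑ a, ∑ b, ∑ c, r a b c = ∑ a, ∑ b, ∑ c, M a b c := by
    have e : ∀ a b, ∑ c, r a b c = AB a b := by
      intro a b
      simp only [hr]
      rw [← Finset.sum_div, ← Finset.mul_sum, hBC']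
      rcases (hB0 b).eq_or_lt with h0 | h0
      · have := leB a b
        have := hAB0 a b
        rw [← h0, div_zero]; linarith
      · field_simp
    simp only [e, hAB]
  have sM : ∑ a, ∑ b, ∑ c, Real.negMulLog (M a b c) =
      -∑ a, ∑ b, ∑ c, M a b c * Real.log (M a b c) := by
    simp [Real.negMulLog]
  have sAB : ∑ a, ∑ b, Real.negMulLog (AB a b) =
      -∑ a, ∑ b, ∑ c, M a b c * Real.log (AB a b) := by
    simp [Real.negMulLog, ← Finset.sum_mul, hAB]
  have sBC : ∑ b, ∑ c, Real.negMulLog (BC b c) =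
      -∑ a, ∑ b, ∑ c, M a b c * Real.log (BC b c) := by
    rw [Finset.sum_comm (s := (Finset.univ : Finset α)), ← Finset.sum_neg_distrib]
    refine Finset.sum_congr rfl fun b _ => ?_
    rw [Finset.sum_comm]
    simp [Real.negMulLog, ← Finset.sum_mul, hBC]
  have sB : ∑ b, Real.negMulLog (B b) =
      -∑ a, ∑ b, ∑ c, M a b c * Real.log (B b) := by
    rw [Finset.sum_comm]
    simp [Real.negMulLog, ← Finset.sum_mul, hAB, hBA]
  have total : ∑ a, ∑ b, ∑ c,
      (M a b c * Real.log (M a b c / r a b c) + r a b c - M a b c) = 0 := by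
    simp only [key, Finset.sum_add_distrib, Finset.sum_sub_distrib]
    linarith
  have nn := fun a b c => mul_log_div_add_sub_nonneg (hM a b c) (hr0 a b c) (hrM a b c)
  have t1 := (Finset.sum_eq_zero_iff_of_nonneg fun a _ => Finset.sum_nonneg fun b _ =>
    Finset.sum_nonneg fun c _ => (nn a b c).1).1 total a (Finset.mem_univ a)
  have t2 := (Finset.sum_eq_zero_iff_of_nonneg fun b _ =>
    Finset.sum_nonneg fun c _ => (nn a b c).1).1 t1 b (Finset.mem_univ b)
  have t3 := (Finset.sum_eq_zero_iff_of_nonneg fun c _ => (nn a b c).1).1 t2 c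
    (Finset.mem_univ c)
  have eq := (nn a b c).2 t3
  rcases (hB0 b).eq_or_lt with h0 | h0
  · have h1 : AB a b = 0 := le_antisymm (h0 ▸ leB a b) (hAB0 a b)
    rw [← h0, h1]; ring
  · rw [eq, hr]
    field_simp

/-- `I(A ; C ∣ B) = 0` implies `p(a,b,c) p(b) = p(a,b) p(b,c)`. -/
theorem marginal_mul_marginal_of_cmi_eq_zero {Ω α β γ : Type*} [Fintype Ω] [Fintype α]
    [Fintype β] [Fintype γ] {p : Ω → ℝ} (hp : ∀ ω, 0 ≤ p ω) {A : Ω → α} {B : Ω → β}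
    {C : Ω → γ} (h : cmi p A B C = 0) (a : α) (b : β) (c : γ) :
    marginal p (fun ω => (A ω, B ω, C ω)) (a, b, c) * marginal p B b =
      marginal p (fun ω => (A ω, B ω)) (a, b) * marginal p (fun ω => (B ω, C ω)) (b, c) := by
  refine mul_eq_mul_of_entropies
    (fun a b c => marginal p (fun ω => (A ω, B ω, C ω)) (a, b, c))
    (fun a b => marginal p (fun ω => (A ω, B ω)) (a, b))
    (fun b c => marginal p (fun ω => (B ω, C ω)) (b, c)) (fun b => marginal p B b)
    (fun a b c => marginal_nonneg hp _ _) (fun a b => ?_)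
    (fun b c => sum_marginal_prod' p A (fun ω => (B ω, C ω)) (b, c))
    (fun b => sum_marginal_prod' p A B b) (fun b => sum_marginal_prod p B C b) ?_ a b c
  · rw [← sum_marginal_prod p (fun ω => (A ω, B ω)) C (a, b)]
    simp only [marginal, Prod.mk.injEq, and_assoc]
  · simp only [cmi, Hof_eq_sum_marginal, ← add_div, ← sub_div] at h
    have := (div_eq_zero_iff.1 h).resolve_right (Real.log_pos one_lt_two).ne'
    simpa only [Fintype.sum_prod_type] using this

theorem alphaVec_eq_of_proportional {𝒳 𝒴 𝒵 : Type*} [Fintype 𝒳] {Q : 𝒳 → 𝒴 → 𝒵 → ℝ}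
    {y : 𝒴} {z : 𝒵} {c : ℝ} (hc : 0 < c) {g : 𝒳 → ℝ} (h : ∀ x, Q x y z = c * g x) :
    alphaVec Q y z = fun x => g x / ∑ x', g x' := by
  ext x
  simp only [alphaVec, h, ← Finset.mul_sum]
  exact mul_div_mul_left _ _ hc.ne'

theorem alphaVec_eq_of_mem_classOf {𝒳 𝒴 𝒵 : Type*} [Fintype 𝒳] {Q : 𝒳 → 𝒴 → 𝒵 → ℝ}
    {y : 𝒴} {z z₀ : 𝒵} (h : z ∈ classOf Q y z₀) : alphaVec Q y z = alphaVec Q y z₀ := by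
  change Relation.EqvGen (SimRel Q y) z z₀ at h
  induction h with
  | rel z z' h =>
    obtain ⟨-, -, c, hc, h⟩ := h
    exact alphaVec_eq_of_proportional hc h
  | refl z => rfl
  | symm _ _ _ ih => exact ih.symm
  | trans _ _ _ _ _ ih₁ ih₂ => exact ih₁.trans ih₂

/-- `Finset.sum_ite_irrel` for decidability instances that vary with the summation index. -/
theorem sum_ite_zero_irrel {ι : Type*} (s : Finset ι) (q : Prop) [Decidable q]
    (d : ι → Decidable q) (f : ι → ℝ) : (∑ i ∈ s, @ite _ q (d i) (f i) 0) = if q then ∑ i ∈ s, f i else 0 := by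
  by_cases h : q <;> simp [h]

/-- If the message `u` occurs together with `(y, z)`, then the column of `z` at `y` is
proportional to `x ↦ p(u|x)`. -/
theorem column_proportional_of_secureAux {𝒳 𝒴 𝒵 : Type*} [Fintype 𝒳] [Fintype 𝒴]
    [Fintype 𝒵] {pXY : 𝒳 × 𝒴 → ℝ} {Q : 𝒳 → 𝒴 → 𝒵 → ℝ}
    (hQ : ∀ x y, IsPMF (Q x y)) (hfs : ∀ x y, 0 < pXY (x, y)) {k : ℕ}
    {pU : 𝒳 × 𝒴 × 𝒵 → Fin k → ℝ} (hU : SecureAux pXY Q pU) {u : Fin k} {y : 𝒴} {z : 𝒵}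
    (hpos : 0 < ∑ x, jointU pXY Q pU (u, (x, y, z))) :
    ∃ c : ℝ, 0 < c ∧ ∀ x, Q x y z =
      c * ((∑ y', ∑ z', jointU pXY Q pU (u, (x, y', z'))) / ∑ y', pXY (x, y')) := by
  obtain ⟨hpmf, h1, h2, h3⟩ := hU
  have hP : ∀ w, 0 ≤ jointU pXY Q pU w := fun ⟨u, x, y, z⟩ =>
    mul_nonneg (mul_nonneg (hfs x y).le ((hQ x y).1 z)) ((hpmf _).1 u)
  have sumU : ∀ x y z, ∑ u, jointU pXY Q pU (u, (x, y, z)) = pXY (x, y) * Q x y z := by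
    intro x y z
    simp only [jointU, ← Finset.mul_sum, (hpmf _).2, mul_one, jointXYZ]
  have sumUZ : ∀ x y, ∑ u, ∑ z, jointU pXY Q pU (u, (x, y, z)) = pXY (x, y) := by
    intro x y
    rw [Finset.sum_comm]
    simp only [sumU, ← Finset.mul_sum, (hQ x y).2, mul_one]
  have sumUYZ : ∀ x, ∑ u, ∑ y, ∑ z, jointU pXY Q pU (u, (x, y, z)) = ∑ y, pXY (x, y) := by
    intro x
    rw [Finset.sum_comm]
    simp only [sumUZ]
  have f1 := fun x => marginal_mul_marginal_of_cmi_eq_zero hP h1 u x y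
  have f2 := fun x => marginal_mul_marginal_of_cmi_eq_zero hP h2 z (u, y) x
  have f3 := fun x => marginal_mul_marginal_of_cmi_eq_zero hP h3 u (y, z) x
  clear h1 h2 h3
  simp only [marginal, Finset.sum_filter, Fintype.sum_prod_type, Prod.mk.injEq, ite_and,
    Finset.sum_ite_eq', Finset.mem_univ, if_true, sum_ite_zero_irrel, sumU, sumUZ,
    sumUYZ] at f1 f2 f3
  set s := ∑ x, jointU pXY Q pU (u, x, y, z)
  set T := ∑ x, ∑ z', jointU pXY Q pU (u, x, y, z')
  set R := ∑ u', ∑ x, jointU pXY Q pU (u', x, y, z)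
  have T0 : 0 < T := hpos.trans_le <| Finset.sum_le_sum fun x _ =>
    Finset.single_le_sum (f := fun z => jointU pXY Q pU (u, x, y, z)) (fun _ _ => hP _)
      (Finset.mem_univ z)
  have R0 : 0 < R := hpos.trans_le <|
    Finset.single_le_sum (f := fun u => ∑ x, jointU pXY Q pU (u, x, y, z))
      (fun _ _ => Finset.sum_nonneg fun _ _ => hP _) (Finset.mem_univ u)
  refine ⟨R / T, div_pos R0 T0, fun x => ?_⟩
  have e1 := f1 x
  have e2 := f2 x
  have e3 := f3 x
  have p0 := hfs x y
  have S0 : 0 < ∑ y', pXY (x, y') := Finset.sum_pos (fun y' _ => hfs x y') ⟨y, Finset.mem_univ y⟩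
  set G := ∑ z', jointU pXY Q pU (u, x, y, z')
  set H := ∑ y', ∑ z', jointU pXY Q pU (u, x, y', z')
  have e4 : pXY (x, y) * Q x y z * T = G * R := by
    refine mul_left_cancel₀ hpos.ne' ?_
    linear_combination R * e2 - T * e3
  have e5 : Q x y z * T * ∑ y', pXY (x, y') = H * R := by
    refine mul_left_cancel₀ p0.ne' ?_
    linear_combination (∑ y', pXY (x, y')) * e4 + R * e1
  field_simp
  linear_combination e5

variable {𝒳 𝒴 𝒵 : Type*} [Fintype 𝒳] [Fintype 𝒴] [Fintype 𝒵]
variable [Nonempty 𝒳] [Nonempty 𝒴] [Nonempty 𝒵]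

/-- **Claim 1.** Under full support and perfect security (witnessed by
`p_{U|XYZ}`): if the probability vectors of the class of `z₀` at `y` and of the class
of `z₀'` at `y'` differ, then the corresponding message sets `U_i^(y)` and `U_j^(y')`
are disjoint. Here `U_i^(y) = {u : p(u,z|y) > 0 for some z ∈ Z_i^(y)}`, and
`p(u,z|y) > 0` is expressed (using `p(y) > 0`) as `0 < Σ_x p(u,x,y,z)`. -/
theorem disjoint_message_sets
    (pXY : 𝒳 × 𝒴 → ℝ) (Q : 𝒳 → 𝒴 → 𝒵 → ℝ)
    (hpXY : IsPMF pXY) (hQ : ∀ x y, IsPMF (Q x y))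
    (hfs : ∀ x y, 0 < pXY (x, y))
    (k : ℕ) (pU : 𝒳 × 𝒴 × 𝒵 → Fin k → ℝ) (hU : SecureAux pXY Q pU)
    (y y' : 𝒴) (z₀ z₀' : 𝒵) (hz₀ : z₀ ∈ Zyset Q y) (hz₀' : z₀' ∈ Zyset Q y')
    (hα : alphaVec Q y z₀ ≠ alphaVec Q y' z₀') :
    {u : Fin k | ∃ z ∈ classOf Q y z₀, 0 < ∑ x, jointU pXY Q pU (u, (x, y, z))} ∩
      {u : Fin k | ∃ z ∈ classOf Q y' z₀', 0 < ∑ x, jointU pXY Q pU (u, (x, y', z))}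
      = ∅ := by
  refine Set.eq_empty_iff_forall_notMem.2 ?_
  rintro u ⟨⟨z, hz, hpos⟩, ⟨z', hz', hpos'⟩⟩
  obtain ⟨c, hc, h⟩ := column_proportional_of_secureAux hQ hfs hU hpos
  obtain ⟨c', hc', h'⟩ := column_proportional_of_secureAux hQ hfs hU hpos'
  apply hα
  rw [← alphaVec_eq_of_mem_classOf hz, ← alphaVec_eq_of_mem_classOf hz',
    alphaVec_eq_of_proportional hc h, alphaVec_eq_of_proportional hc' h']

end SC
end

section
/- For all y, y' ∈ Y: k(y) = k(y') (call the common value k), and {α_1^(y), α_2^(y), …, α_k^(y)} = {α_1^(y'), α_2^(y'), …, α_k^(y')} as sets of probability vectors on X. -/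
open scoped BigOperators
open scoped Classical

namespace SC

/-- The mass at `b` of the pushforward of `p` along `f`. -/
noncomputable def marg {Ω β : Type*} [Fintype Ω] (p : Ω → ℝ) (f : Ω → β) (b : β) : ℝ :=
  ∑ ω, if f ω = b then p ω else 0

lemma Hof_eq_sum_marg {Ω β : Type*} [Fintype Ω] [Fintype β] (p : Ω → ℝ) (f : Ω → β) :
    Hof p f = (∑ b, Real.negMulLog (marg p f b)) / Real.log 2 := by
  unfold Hof marg
  congr 1
  simp only [Finset.sum_filter]
  refine Finset.sum_subset (Finset.subset_univ _) fun b _ hb => ?_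
  rw [Finset.sum_eq_zero, Real.negMulLog_zero]
  intro ω _
  rw [if_neg]
  rintro rfl
  exact hb (Finset.mem_image_of_mem f (Finset.mem_univ ω))

/-- Marginalizing a pair on its second coordinate. -/
lemma marg_fst {Ω β γ : Type*} [Fintype Ω] [Fintype γ] (p : Ω → ℝ) (f : Ω → β) (g : Ω → γ)
    (b : β) : marg p f b = ∑ c, marg p (fun ω => (f ω, g ω)) (b, c) := by
  unfold marg
  rw [Finset.sum_comm]
  refine Finset.sum_congr rfl fun ω _ => ?_
  by_cases h : f ω = b <;> simp [h]

/-- Marginalizing a pair on its first coordinate. -/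
lemma marg_snd {Ω β γ : Type*} [Fintype Ω] [Fintype β] (p : Ω → ℝ) (f : Ω → β) (g : Ω → γ)
    (c : γ) : marg p g c = ∑ b, marg p (fun ω => (f ω, g ω)) (b, c) := by
  unfold marg
  rw [Finset.sum_comm]
  refine Finset.sum_congr rfl fun ω _ => ?_
  by_cases h : g ω = c <;> simp [h]

/-- Pulling a condition out of a sum, even if the decidability instance varies with the index. -/
lemma sum_ite_irrel_zero {ι : Type*} [Fintype ι] (P : Prop) (d : ι → Decidable P) (f : ι → ℝ) :
    (∑ i, @ite _ P (d i) (f i) 0) = if P then ∑ i, f i else 0 := by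
  by_cases h : P <;> simp [h]

lemma kl_term_nonneg {f q : ℝ} (hf : 0 ≤ f) (hq : 0 ≤ q) (h : q = 0 → f = 0) :
    0 ≤ f * Real.log f - f * Real.log q - f + q := by
  rcases hf.eq_or_lt with rfl | hf
  · simpa using hq
  have hq : 0 < q := hq.lt_of_ne fun e => hf.ne' (h e.symm)
  have h1 := mul_le_mul_of_nonneg_left (Real.log_le_sub_one_of_pos (div_pos hq hf)) hf.le
  rw [Real.log_div hq.ne' hf.ne', mul_sub, mul_sub, mul_div_cancel₀ _ hf.ne'] at h1
  linarith

lemma eq_of_kl_term_eq_zero {f q : ℝ} (hf : 0 ≤ f) (hq : 0 ≤ q) (h : q = 0 → f = 0)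
    (h0 : f * Real.log f - f * Real.log q - f + q = 0) : f = q := by
  rcases hf.eq_or_lt with rfl | hf
  · simpa using h0.symm
  have hq : 0 < q := hq.lt_of_ne fun e => hf.ne' (h e.symm)
  by_contra hne
  have hne' : q / f ≠ 1 := fun e => hne ((div_eq_one_iff_eq hf.ne').1 e).symm
  have h1 := mul_lt_mul_of_pos_left (Real.log_lt_sub_one_of_pos (div_pos hq hf) hne') hf
  rw [Real.log_div hq.ne' hf.ne', mul_sub, mul_sub, mul_div_cancel₀ _ hf.ne'] at h1
  linarith

/-- Vanishing conditional mutual information forces conditional independence, for an array of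
nonnegative masses. -/
lemma factor_of_entropy_eq {α β γ : Type*} [Fintype α] [Fintype β] [Fintype γ]
    (F : α → β → γ → ℝ) (hF : ∀ a b c, 0 ≤ F a b c)
    (h : ∑ a, ∑ b, Real.negMulLog (∑ c, F a b c) + ∑ b, ∑ c, Real.negMulLog (∑ a, F a b c)
      - ∑ b, Real.negMulLog (∑ a, ∑ c, F a b c)
      - ∑ a, ∑ b, ∑ c, Real.negMulLog (F a b c) = 0) (a : α) (b : β) (c : γ) :
    F a b c * ∑ a, ∑ c, F a b c = (∑ c, F a b c) * ∑ a, F a b c := by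
  set AB : α → β → ℝ := fun a b => ∑ c, F a b c with hAB
  set BC : β → γ → ℝ := fun b c => ∑ a, F a b c with hBC
  set B : β → ℝ := fun b => ∑ a, ∑ c, F a b c with hB
  have AB0 : ∀ a b, 0 ≤ AB a b := fun a b => Finset.sum_nonneg fun c _ => hF a b c
  have BC0 : ∀ b c, 0 ≤ BC b c := fun b c => Finset.sum_nonneg fun a _ => hF a b c
  have B0 : ∀ b, 0 ≤ B b := fun b => Finset.sum_nonneg fun a _ => AB0 a b
  have leAB : ∀ a b c, F a b c ≤ AB a b := fun a b c =>
    Finset.single_le_sum (fun c _ => hF a b c) (Finset.mem_univ c)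
  have leBC : ∀ a b c, F a b c ≤ BC b c := fun a b c =>
    Finset.single_le_sum (fun a _ => hF a b c) (Finset.mem_univ a)
  have leB : ∀ a b, AB a b ≤ B b := fun a b =>
    Finset.single_le_sum (fun a _ => AB0 a b) (Finset.mem_univ a)
  have B_eq : ∀ b, B b = ∑ c, BC b c := fun b => Finset.sum_comm
  set q : α → β → γ → ℝ := fun a b c => AB a b * BC b c / B b with hq
  have q0 : ∀ a b c, 0 ≤ q a b c := fun a b c =>
    div_nonneg (mul_nonneg (AB0 a b) (BC0 b c)) (B0 b)
  have hpos : ∀ a b c, 0 < F a b c → 0 < AB a b ∧ 0 < BC b c ∧ 0 < B b := fun a b c hf =>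
    ⟨hf.trans_le (leAB a b c), hf.trans_le (leBC a b c),
      hf.trans_le ((leAB a b c).trans (leB a b))⟩
  have hac : ∀ a b c, q a b c = 0 → F a b c = 0 := by
    intro a b c hqz
    by_contra hne
    obtain ⟨h1, h2, h3⟩ := hpos a b c ((hF a b c).lt_of_ne' hne)
    exact (div_pos (mul_pos h1 h2) h3).ne' hqz
  have hlog : ∀ a b c, F a b c * Real.log (q a b c) =
      F a b c * Real.log (AB a b) + F a b c * Real.log (BC b c)
        - F a b c * Real.log (B b) := by
    intro a b c
    rcases (hF a b c).eq_or_lt with hz | hf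
    · simp [← hz]
    obtain ⟨h1, h2, h3⟩ := hpos a b c hf
    rw [hq]
    simp only
    rw [Real.log_div (mul_pos h1 h2).ne' h3.ne', Real.log_mul h1.ne' h2.ne']
    ring
  have s1 : ∑ a, ∑ b, ∑ c, F a b c * Real.log (AB a b) =
      -∑ a, ∑ b, Real.negMulLog (AB a b) := by
    simp only [Real.negMulLog, ← Finset.sum_mul, neg_mul, Finset.sum_neg_distrib, neg_neg, hAB]
  have s2 : ∑ a, ∑ b, ∑ c, F a b c * Real.log (BC b c) =
      -∑ b, ∑ c, Real.negMulLog (BC b c) := by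
    rw [Finset.sum_comm]
    simp only [Real.negMulLog, neg_mul, Finset.sum_neg_distrib, neg_neg]
    refine Finset.sum_congr rfl fun b _ => ?_
    rw [Finset.sum_comm]
    simp only [← Finset.sum_mul, hBC]
  have s3 : ∑ a, ∑ b, ∑ c, F a b c * Real.log (B b) = -∑ b, Real.negMulLog (B b) := by
    rw [Finset.sum_comm]
    simp only [Real.negMulLog, neg_mul, Finset.sum_neg_distrib, neg_neg, ← Finset.sum_mul, hB]
  have s4 : ∑ a, ∑ b, ∑ c, F a b c * Real.log (F a b c) =
      -∑ a, ∑ b, ∑ c, Real.negMulLog (F a b c) := by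
    simp only [Real.negMulLog, neg_mul, Finset.sum_neg_distrib, neg_neg]
  have s5 : ∑ a, ∑ b, ∑ c, q a b c = ∑ a, ∑ b, ∑ c, F a b c := by
    rw [Finset.sum_comm, Finset.sum_comm (f := fun a b => ∑ c, F a b c)]
    refine Finset.sum_congr rfl fun b _ => ?_
    change _ = B b
    have : ∑ a, ∑ c, q a b c = B b * B b / B b := by
      simp only [hq, ← Finset.sum_div, ← Finset.mul_sum, ← Finset.sum_mul, ← B_eq]
      rfl
    rw [this, mul_self_div_self]
  have hsum : ∑ a, ∑ b, ∑ c, (F a b c * Real.log (F a b c) - F a b c * Real.log (q a b c)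
      - F a b c + q a b c) = 0 := by
    simp only [hlog, Finset.sum_add_distrib, Finset.sum_sub_distrib, s1, s2, s3, s4, s5]
    linarith
  have t0 : ∀ a b c, 0 ≤ F a b c * Real.log (F a b c) - F a b c * Real.log (q a b c)
      - F a b c + q a b c := fun a b c => kl_term_nonneg (hF a b c) (q0 a b c) (hac a b c)
  have e1 := (Finset.sum_eq_zero_iff_of_nonneg fun a _ => Finset.sum_nonneg fun b _ =>
    Finset.sum_nonneg fun c _ => t0 a b c).1 hsum a (Finset.mem_univ a)
  have e2 := (Finset.sum_eq_zero_iff_of_nonneg fun b _ =>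
    Finset.sum_nonneg fun c _ => t0 a b c).1 e1 b (Finset.mem_univ b)
  have e3 := (Finset.sum_eq_zero_iff_of_nonneg fun c _ => t0 a b c).1 e2 c (Finset.mem_univ c)
  have e4 := eq_of_kl_term_eq_zero (hF a b c) (q0 a b c) (hac a b c) e3
  change F a b c * B b = AB a b * BC b c
  rcases (B0 b).eq_or_lt with hz | hb
  · have : AB a b = 0 := le_antisymm (hz ▸ leB a b) (AB0 a b)
    rw [← hz, this, mul_zero, zero_mul]
  · rw [e4]
    exact div_mul_cancel₀ _ hb.ne'

/-- `I(A ; C ∣ B) = 0` implies `p(a,b,c) p(b) = p(a,b) p(b,c)`. -/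
lemma marg_mul_marg_of_cmi_eq_zero {Ω α β γ : Type*} [Fintype Ω] [Fintype α] [Fintype β]
    [Fintype γ] (p : Ω → ℝ) (hp : ∀ ω, 0 ≤ p ω) (A : Ω → α) (B : Ω → β) (C : Ω → γ)
    (h : cmi p A B C = 0) (a : α) (b : β) (c : γ) :
    marg p (fun ω => (A ω, B ω, C ω)) (a, b, c) * marg p B b =
      marg p (fun ω => (A ω, B ω)) (a, b) * marg p (fun ω => (B ω, C ω)) (b, c) := by
  have hAB : ∀ a b, marg p (fun ω => (A ω, B ω)) (a, b) =
      ∑ c, marg p (fun ω => (A ω, B ω, C ω)) (a, b, c) := by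
    intro a b
    rw [marg_fst p _ C]
    simp only [marg, Prod.mk.injEq, and_assoc]
  have hBC : ∀ b c, marg p (fun ω => (B ω, C ω)) (b, c) =
      ∑ a, marg p (fun ω => (A ω, B ω, C ω)) (a, b, c) := fun b c => marg_snd p A _ _
  have hB : ∀ b, marg p B b = ∑ a, ∑ c, marg p (fun ω => (A ω, B ω, C ω)) (a, b, c) := by
    intro b
    rw [marg_snd p A]
    simp only [hAB]
  have hlog2 : Real.log 2 ≠ 0 := (Real.log_pos one_lt_two).ne'
  unfold cmi at h
  simp only [Hof_eq_sum_marg, ← add_div, ← sub_div, div_eq_zero_iff, hlog2, or_false,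
    Fintype.sum_prod_type] at h
  simp only [hAB, hBC, hB] at h ⊢
  refine factor_of_entropy_eq (fun a b c => marg p (fun ω => (A ω, B ω, C ω)) (a, b, c)) ?_ h a b c
  intro a b c
  refine Finset.sum_nonneg fun ω _ => ?_
  split_ifs
  exacts [hp ω, le_rfl]

variable {𝒳 𝒴 𝒵 : Type*} [Fintype 𝒳] [Fintype 𝒴] [Fintype 𝒵]

/-- Under perfect security, every output column at `y` is proportional to some output column
at `y'`. -/
lemma PerfectlySecure.exists_proportional
    {pXY : 𝒳 × 𝒴 → ℝ} {Q : 𝒳 → 𝒴 → 𝒵 → ℝ}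
    (hQ : ∀ x y, IsPMF (Q x y)) (hfs : ∀ x y, 0 < pXY (x, y))
    (hps : PerfectlySecure pXY Q) (y y' : 𝒴) {z : 𝒵} (hz : z ∈ Zyset Q y) :
    ∃ z' ∈ Zyset Q y', ∃ c : ℝ, 0 < c ∧ ∀ x, Q x y z = c * Q x y' z' := by
  obtain ⟨k, pU, hU, h1, h2, h3⟩ := hps
  set J : Fin k → 𝒳 → 𝒴 → 𝒵 → ℝ := fun u x y z => jointU pXY Q pU (u, x, y, z) with hJ
  have J0 : ∀ w, 0 ≤ jointU pXY Q pU w := fun w =>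
    mul_nonneg (mul_nonneg (hfs _ _).le ((hQ _ _).1 _)) ((hU _).1 _)
  have JQ : ∀ x y z, ∑ u, J u x y z = pXY (x, y) * Q x y z := by
    intro x y z
    simp only [hJ, jointU, jointXYZ, ← Finset.mul_sum, (hU _).2, mul_one]
  have c1 : ∀ u x y, (∑ z, J u x y z) * ∑ u, ∑ y, ∑ z, J u x y z =
      (∑ y, ∑ z, J u x y z) * ∑ u, ∑ z, J u x y z := by
    intro u x y
    have := marg_mul_marg_of_cmi_eq_zero _ J0 _ _ _ h1 u x y
    simpa [marg, Fintype.sum_prod_type, ite_and, sum_ite_irrel_zero, hJ] using this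
  have c2 : ∀ u x y z, J u x y z * ∑ x, ∑ z, J u x y z =
      (∑ x, J u x y z) * ∑ z, J u x y z := by
    intro u x y z
    have := marg_mul_marg_of_cmi_eq_zero _ J0 _ _ _ h2 z (u, y) x
    simpa [marg, Fintype.sum_prod_type, ite_and, sum_ite_irrel_zero, hJ] using this
  have c3 : ∀ u x y z, J u x y z * ∑ u, ∑ x, J u x y z =
      (∑ x, J u x y z) * ∑ u, J u x y z := by
    intro u x y z
    have := marg_mul_marg_of_cmi_eq_zero _ J0 _ _ _ h3 u (y, z) x
    simpa [marg, Fintype.sum_prod_type, ite_and, sum_ite_irrel_zero, hJ] using this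
  have J0' : ∀ u x y z, 0 ≤ J u x y z := fun u x y z => J0 _
  set r : 𝒳 → Fin k → ℝ := fun x u => (∑ y, ∑ z, J u x y z) / ∑ y, pXY (x, y) with hr
  have Jr : ∀ u x y, ∑ z, J u x y z = pXY (x, y) * r x u := by
    intro u x y
    have e : ∀ y, ∑ u, ∑ z, J u x y z = pXY (x, y) := by
      intro y
      rw [Finset.sum_comm]
      simp only [JQ, ← Finset.mul_sum, (hQ _ _).2, mul_one]
    have e' : ∑ u, ∑ y, ∑ z, J u x y z = ∑ y, pXY (x, y) := by
      rw [Finset.sum_comm]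
      simp only [e]
    have hpos : 0 < ∑ y, pXY (x, y) :=
      Finset.sum_pos (fun y _ => hfs x y) ⟨y, Finset.mem_univ y⟩
    have := c1 u x y
    rw [e, e'] at this
    simp only [hr]
    field_simp
    linarith
  have key : ∀ u x₀ y z, 0 < J u x₀ y z → ∃ c : ℝ, 0 < c ∧ ∀ x, r x u = c * Q x y z := by
    intro u x₀ y z hpos
    have hN : 0 < ∑ x, J u x y z :=
      Finset.sum_pos' (fun x _ => J0' u x y z) ⟨x₀, Finset.mem_univ _, hpos⟩
    have hD2 : 0 < ∑ x, ∑ z, J u x y z :=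
      Finset.sum_pos' (fun x _ => Finset.sum_nonneg fun z _ => J0' u x y z)
        ⟨x₀, Finset.mem_univ _,
          Finset.sum_pos' (fun z _ => J0' u x₀ y z) ⟨z, Finset.mem_univ _, hpos⟩⟩
    have hD3 : 0 < ∑ u, ∑ x, J u x y z :=
      Finset.sum_pos' (fun u _ => Finset.sum_nonneg fun x _ => J0' u x y z)
        ⟨u, Finset.mem_univ _, hN⟩
    refine ⟨_, div_pos hD2 hD3, fun x => ?_⟩
    have d2 := c2 u x y z
    have d3 := c3 u x y z
    rw [Jr] at d2
    rw [JQ] at d3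
    have hp := hfs x y
    rw [div_mul_eq_mul_div, eq_div_iff hD3.ne']
    refine mul_left_cancel₀ (mul_pos hN hp).ne' ?_
    linear_combination (∑ x, ∑ z, J u x y z) * d3 - (∑ u, ∑ x, J u x y z) * d2
  obtain ⟨x₀, hx₀⟩ := hz
  obtain ⟨u, -, hu⟩ : ∃ u ∈ Finset.univ, 0 < J u x₀ y z := by
    refine Finset.exists_lt_of_sum_lt ?_
    rw [JQ, Finset.sum_const_zero]
    exact mul_pos (hfs x₀ y) hx₀
  obtain ⟨c, hc, hcr⟩ := key u x₀ y z hu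
  obtain ⟨z', -, hz'⟩ : ∃ z' ∈ Finset.univ, 0 < J u x₀ y' z' := by
    refine Finset.exists_lt_of_sum_lt ?_
    rw [Jr, hcr, Finset.sum_const_zero]
    exact mul_pos (hfs x₀ y') (mul_pos hc hx₀)
  obtain ⟨c', hc', hcr'⟩ := key u x₀ y' z' hz'
  refine ⟨z', ⟨x₀, ?_⟩, c' / c, div_pos hc' hc, fun x => ?_⟩
  · refine pos_of_mul_pos_right ?_ hc'.le
    rw [← hcr', hcr]
    exact mul_pos hc hx₀
  · rw [div_mul_eq_mul_div, ← hcr', hcr, mul_div_cancel_left₀ _ hc.ne']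

lemma PerfectlySecure.alphaSet_subset
    {pXY : 𝒳 × 𝒴 → ℝ} {Q : 𝒳 → 𝒴 → 𝒵 → ℝ}
    (hQ : ∀ x y, IsPMF (Q x y)) (hfs : ∀ x y, 0 < pXY (x, y))
    (hps : PerfectlySecure pXY Q) (y y' : 𝒴) : alphaSet Q y ⊆ alphaSet Q y' := by
  rintro _ ⟨z, hz, rfl⟩
  obtain ⟨z', hz', c, hc, h⟩ := hps.exists_proportional hQ hfs y y' hz
  refine ⟨z', hz', funext fun x => ?_⟩
  simp only [alphaVec, h, ← Finset.mul_sum, mul_div_mul_left _ _ hc.ne']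

variable [Nonempty 𝒳] [Nonempty 𝒴] [Nonempty 𝒵]

/-- **Claim 2.** Under full support and perfect security: for all
`y, y'`, the number of `≡_y`-classes is the same (`k(y) = k(y')`) and the sets of
probability vectors `{α_i^(y)}` and `{α_j^(y')}` coincide. -/
theorem equal_alpha_sets
    (pXY : 𝒳 × 𝒴 → ℝ) (Q : 𝒳 → 𝒴 → 𝒵 → ℝ)
    (hpXY : IsPMF pXY) (hQ : ∀ x y, IsPMF (Q x y))
    (hfs : ∀ x y, 0 < pXY (x, y))
    (hps : PerfectlySecure pXY Q)
    (y y' : 𝒴) :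
    (alphaSet Q y).ncard = (alphaSet Q y').ncard ∧ alphaSet Q y = alphaSet Q y' := by
  have h : alphaSet Q y = alphaSet Q y' :=
    (hps.alphaSet_subset hQ hfs y y').antisymm (hps.alphaSet_subset hQ hfs y' y)
  exact ⟨congrArg Set.ncard h, h⟩

end SC
end
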